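/- arXiv:math/0601082 — 4 statements merged into one kernel-verified Lean document; each statement's English description precedes it below -/
import Mathlib

section
/- For every real number v > 0, setting r = v/(1 + √(1 + v²)) (so 0 < r < 1), one has TS(v,1) = (π/2) ∫₀ᵛ (arctan u)/u du − (1/4)·Li₃(r²) − 2·Li₃(1−r) − 2·Li₃(r/(1+r)) + 2·ζ(3) + (1/2)·log((1+r)/(1−r))·Li₂(r²) + (π²/3)·log(1−r) + (1/3)·log³(1+r) − log(r)·log²(1−r). -/
open Real MeasureTheory intervalIntegral

/-- `TS(v,w) = ∫₀¹ arctan(vx) arcsin(wx) / x dx` -/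
noncomputable def TS (v w : ℝ) : ℝ :=
  ∫ x in (0:ℝ)..1, Real.arctan (v * x) * Real.arcsin (w * x) / x

/-- The polylogarithm `Li_k(z) = ∑_{n≥1} zⁿ/n^k` (real). -/
noncomputable def Li (k : ℕ) (z : ℝ) : ℝ := ∑' n : ℕ, z ^ (n + 1) / ((n + 1 : ℕ) : ℝ) ^ k

open Filter Topology Set

/-- A function with vanishing derivative on `(0, 1)` equals its right limit at `0` there. -/
theorem eq_of_hasDerivAt_zero_of_tendsto {f : ℝ → ℝ} {c : ℝ}
    (hf : ∀ x ∈ Ioo (0 : ℝ) 1, HasDerivAt f 0 x) (hlim : Tendsto f (𝓝[>] 0) (𝓝 c))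
    {x : ℝ} (hx : x ∈ Ioo (0 : ℝ) 1) : f x = c := by
  obtain ⟨a, ha⟩ := isOpen_Ioo.exists_is_const_of_deriv_eq_zero isPreconnected_Ioo
    (fun y hy => (hf y hy).differentiableAt.differentiableWithinAt) (fun y hy => (hf y hy).deriv)
  have hev : f =ᶠ[𝓝[>] 0] fun _ => a := by
    filter_upwards [Ioo_mem_nhdsGT (zero_lt_one (α := ℝ))] with y hy using ha y hy
  rw [ha x hx, tendsto_nhds_unique (tendsto_const_nhds.congr' hev.symm) hlim]

theorem Li_one_eq_neg_log {x : ℝ} (hx : |x| < 1) : Li 1 x = -log (1 - x) := by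
  rw [← (hasSum_pow_div_log_of_abs_lt_one hx).tsum_eq, Li]
  simp

theorem Li_zero (k : ℕ) : Li k 0 = 0 := by simp [Li]

theorem Li_two_one : Li 2 1 = π ^ 2 / 6 := by
  have h := hasSum_zeta_two
  rw [← hasSum_nat_add_iff' 1] at h
  simpa [Li] using h.tsum_eq

theorem hasDerivAt_Li_succ (k : ℕ) {x : ℝ} (hx : |x| < 1) (hx0 : x ≠ 0) :
    HasDerivAt (Li (k + 1)) (Li k x / x) x := by
  obtain ⟨ρ, hxρ, hρ⟩ := exists_between hx
  have hρ0 : 0 < ρ := (abs_nonneg x).trans_lt hxρ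
  have key := hasDerivAt_tsum_of_isPreconnected (𝕜 := ℝ)
    (g := fun (n : ℕ) (y : ℝ) => y ^ (n + 1) / ((n + 1 : ℕ) : ℝ) ^ (k + 1))
    (g' := fun (n : ℕ) (y : ℝ) => y ^ n / ((n + 1 : ℕ) : ℝ) ^ k)
    (t := Metric.ball 0 ρ) (u := fun n => ρ ^ n) (y₀ := 0) (y := x)
    (summable_geometric_of_lt_one hρ0.le hρ) Metric.isOpen_ball
    (convex_ball _ _).isPreconnected
    (fun n y _ => by
      have hn : ((n + 1 : ℕ) : ℝ) ≠ 0 := by positivity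
      refine ((hasDerivAt_pow (n + 1) y).div_const (((n + 1 : ℕ) : ℝ) ^ (k + 1))).congr_deriv ?_
      simp only [Nat.add_sub_cancel]
      field_simp
      ring)
    (fun n y hy => by
      have hy' : |y| < ρ := by simpa using hy
      rw [norm_div, norm_pow, norm_pow, Real.norm_eq_abs, Real.norm_natCast]
      have h1 : (1 : ℝ) ≤ ((n + 1 : ℕ) : ℝ) ^ k := one_le_pow₀ (by simp)
      exact (div_le_self (by positivity) h1).trans (by gcongr))
    (by simpa using hρ0) (by simp) (by simpa using hxρ)
  refine key.congr_deriv ?_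
  rw [eq_comm, Li, ← tsum_div_const]
  refine tsum_congr fun n => ?_
  field_simp
  ring

theorem continuousOn_Li {k : ℕ} (hk : 2 ≤ k) : ContinuousOn (Li k) (Icc (-1) 1) := by
  refine continuousOn_tsum (u := fun n : ℕ => 1 / ((n + 1 : ℕ) : ℝ) ^ k)
    (fun n => by fun_prop) ?_ ?_
  · exact (summable_nat_add_iff 1).2 (Real.summable_one_div_nat_pow.2 (by omega))
  · intro n x hx
    rw [norm_div, norm_pow, norm_pow, Real.norm_eq_abs, Real.norm_natCast]
    gcongr
    exact pow_le_one₀ (abs_nonneg x) (abs_le.2 hx)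

theorem continuousAt_Li {k : ℕ} (hk : 2 ≤ k) {x : ℝ} (hx : |x| < 1) : ContinuousAt (Li k) x :=
  (continuousOn_Li hk).continuousAt (Icc_mem_nhds (abs_lt.1 hx).1 (abs_lt.1 hx).2)

theorem hasDerivAt_Li_two {x : ℝ} (hx : |x| < 1) (hx0 : x ≠ 0) :
    HasDerivAt (Li 2) (-log (1 - x) / x) x := by
  simpa [Li_one_eq_neg_log hx] using hasDerivAt_Li_succ 1 hx hx0

theorem hasDerivAt_Li_two_neg {x : ℝ} (hx : x ∈ Ioo (0 : ℝ) 1) :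
    HasDerivAt (fun y => Li 2 (-y)) (-log (1 + x) / x) x := by
  have hx' : |-x| < 1 := by rw [abs_neg, abs_of_pos hx.1]; exact hx.2
  have hx0 : x ≠ 0 := hx.1.ne'
  refine ((hasDerivAt_Li_two hx' (neg_ne_zero.2 hx0)).comp x (hasDerivAt_neg x)).congr_deriv ?_
  rw [sub_neg_eq_add]
  field_simp

theorem tendsto_Li_comp_nhdsGT_zero {k : ℕ} (hk : 2 ≤ k) {g : ℝ → ℝ} (hg : ContinuousAt g 0)
    (hg0 : g 0 = 0) : Tendsto (fun x => Li k (g x)) (𝓝[>] 0) (𝓝 0) := by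
  have h : ContinuousAt (fun x => Li k (g x)) 0 :=
    ContinuousAt.comp (f := g) (g := Li k) (by rw [hg0]; exact continuousAt_Li hk (by simp)) hg
  have h' := h.tendsto.mono_left (nhdsWithin_le_nhds (s := Ioi 0))
  simpa [hg0, Li_zero] using h'

theorem tendsto_Li_one_sub_nhdsGT_zero {k : ℕ} (hk : 2 ≤ k) :
    Tendsto (fun x => Li k (1 - x)) (𝓝[>] 0) (𝓝 (Li k 1)) := by
  refine ((continuousOn_Li hk) 1 (by simp)).tendsto.comp (tendsto_nhdsWithin_iff.2 ⟨?_, ?_⟩)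
  · have h : ContinuousAt (fun x : ℝ => 1 - x) 0 := by fun_prop
    simpa using h.tendsto.mono_left (nhdsWithin_le_nhds (s := Ioi 0))
  · filter_upwards [Ioo_mem_nhdsGT (zero_lt_one (α := ℝ))] with x hx
    constructor <;> linarith [hx.1, hx.2]

theorem tendsto_log_one_sub_nhdsGT_zero :
    Tendsto (fun x : ℝ => log (1 - x)) (𝓝[>] 0) (𝓝 0) := by
  have h : ContinuousAt (fun x : ℝ => log (1 - x)) 0 :=
    ContinuousAt.log (by fun_prop) (by norm_num)
  simpa using h.tendsto.mono_left (nhdsWithin_le_nhds (s := Ioi 0))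

theorem tendsto_log_one_add_nhdsGT_zero :
    Tendsto (fun x : ℝ => log (1 + x)) (𝓝[>] 0) (𝓝 0) := by
  have h : ContinuousAt (fun x : ℝ => log (1 + x)) 0 :=
    ContinuousAt.log (by fun_prop) (by norm_num)
  simpa using h.tendsto.mono_left (nhdsWithin_le_nhds (s := Ioi 0))

theorem hasDerivAt_log_one_sub {x : ℝ} (hx : x < 1) :
    HasDerivAt (fun y => log (1 - y)) (-1 / (1 - x)) x :=
  ((hasDerivAt_id x).const_sub 1).log (by simp; linarith)

theorem hasDerivAt_log_one_add {x : ℝ} (hx : -1 < x) :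
    HasDerivAt (fun y => log (1 + y)) (1 / (1 + x)) x :=
  ((hasDerivAt_id x).const_add 1).log (by simp; linarith)

theorem tendsto_log_mul_log_one_sub_nhdsGT_zero :
    Tendsto (fun x : ℝ => log x * log (1 - x)) (𝓝[>] 0) (𝓝 0) := by
  have h1 : Tendsto (fun x : ℝ => x * log x) (𝓝[>] 0) (𝓝 0) := by
    simpa using (continuous_mul_log.tendsto 0).mono_left (nhdsWithin_le_nhds (s := Ioi 0))
  have h2 := (hasDerivAt_log_one_sub zero_lt_one).tendsto_slope.mono_left
    (nhdsWithin_mono 0 (fun x (hx : 0 < x) => hx.ne'))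
  have h3 := h1.mul h2
  rw [zero_mul] at h3
  refine h3.congr' ?_
  filter_upwards [self_mem_nhdsWithin] with x hx
  have hx0 : x ≠ 0 := (Set.mem_Ioi.1 hx).ne'
  simp only [slope_def_field, sub_zero, log_one]
  field_simp

theorem hasDerivAt_Li_two_sq {r : ℝ} (hr : r ∈ Ioo (0 : ℝ) 1) :
    HasDerivAt (fun s => Li 2 (s ^ 2)) (-2 * (log (1 - r) + log (1 + r)) / r) r := by
  have hr0 : r ≠ 0 := hr.1.ne'
  have hr1 : |r ^ 2| < 1 := by
    rw [abs_pow, abs_of_pos hr.1]; exact pow_lt_one₀ hr.1.le hr.2 two_ne_zero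
  refine ((hasDerivAt_Li_two hr1 (by positivity)).comp (h := fun s => s ^ 2) r
    (hasDerivAt_pow 2 r)).congr_deriv ?_
  rw [show 1 - r ^ 2 = (1 - r) * (1 + r) by ring,
    log_mul (by linarith [hr.2]) (by linarith [hr.1])]
  field_simp
  ring

theorem Li_two_sq {x : ℝ} (hx : x ∈ Ioo (0 : ℝ) 1) :
    Li 2 (x ^ 2) = 2 * (Li 2 x + Li 2 (-x)) := by
  refine sub_eq_zero.1 (eq_of_hasDerivAt_zero_of_tendsto
    (f := fun y => Li 2 (y ^ 2) - 2 * (Li 2 y + Li 2 (-y))) (fun y hy => ?_) ?_ hx)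
  · have hy0 : y ≠ 0 := hy.1.ne'
    have hy1 : |y| < 1 := by rw [abs_of_pos hy.1]; exact hy.2
    have hd := (hasDerivAt_Li_two_sq hy).sub
      (((hasDerivAt_Li_two hy1 hy0).add (hasDerivAt_Li_two_neg hy)).const_mul 2)
    refine hd.congr_deriv ?_
    field_simp
    ring
  · simpa using
      (tendsto_Li_comp_nhdsGT_zero le_rfl (g := fun y => y ^ 2) (by fun_prop) (by simp)).sub
      (((tendsto_Li_comp_nhdsGT_zero le_rfl (g := fun y => y) (by fun_prop) rfl).add
        (tendsto_Li_comp_nhdsGT_zero le_rfl (g := fun y => -y) (by fun_prop) (by simp))).const_mul 2)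

/-- Euler's reflection formula for the dilogarithm. -/
theorem Li_two_one_sub {x : ℝ} (hx : x ∈ Ioo (0 : ℝ) 1) :
    Li 2 (1 - x) = π ^ 2 / 6 - log x * log (1 - x) - Li 2 x := by
  have key := eq_of_hasDerivAt_zero_of_tendsto (c := π ^ 2 / 6)
    (f := fun y => Li 2 (1 - y) + log y * log (1 - y) + Li 2 y) (fun y hy => ?_) ?_ hx
  · linarith
  · have hy0 : y ≠ 0 := hy.1.ne'
    have hy1 : |y| < 1 := by rw [abs_of_pos hy.1]; exact hy.2
    have hz0 : 1 - y ≠ 0 := by linarith [hy.2]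
    have hz1 : |1 - y| < 1 := abs_lt.2 ⟨by linarith [hy.2], by linarith [hy.1]⟩
    have hd := (((hasDerivAt_Li_two hz1 hz0).comp y ((hasDerivAt_id y).const_sub 1)).add
      ((hasDerivAt_log hy0).mul (hasDerivAt_log_one_sub hy.2))).add (hasDerivAt_Li_two hy1 hy0)
    refine hd.congr_deriv ?_
    rw [sub_sub_cancel]
    field_simp
    ring
  · simpa [Li_two_one] using ((tendsto_Li_one_sub_nhdsGT_zero le_rfl).add
      tendsto_log_mul_log_one_sub_nhdsGT_zero).add
      (tendsto_Li_comp_nhdsGT_zero le_rfl (g := fun y => y) (by fun_prop) rfl)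

theorem hasDerivAt_div_one_add {x : ℝ} (hx : 1 + x ≠ 0) :
    HasDerivAt (fun y : ℝ => y / (1 + y)) (1 / (1 + x) ^ 2) x := by
  refine ((hasDerivAt_id x).div ((hasDerivAt_id x).const_add 1) hx).congr_deriv ?_
  simp

theorem abs_div_one_add_lt_one {x : ℝ} (hx : 0 < x) : |x / (1 + x)| < 1 := by
  rw [abs_of_pos (by positivity), div_lt_one (by positivity)]
  linarith

/-- Landen's formula for the dilogarithm. -/
theorem Li_two_div_one_add {x : ℝ} (hx : x ∈ Ioo (0 : ℝ) 1) :
    Li 2 (x / (1 + x)) = -Li 2 (-x) - log (1 + x) ^ 2 / 2 := by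
  have key := eq_of_hasDerivAt_zero_of_tendsto (c := 0)
    (f := fun y => Li 2 (y / (1 + y)) + Li 2 (-y) + log (1 + y) ^ 2 / 2) (fun y hy => ?_) ?_ hx
  · linarith
  · have hy0 : y ≠ 0 := hy.1.ne'
    have hp : 0 < 1 + y := by linarith [hy.1]
    have hd := (((hasDerivAt_Li_two (abs_div_one_add_lt_one hy.1) (div_ne_zero hy0 hp.ne')).comp y
      (hasDerivAt_div_one_add hp.ne')).add (hasDerivAt_Li_two_neg hy)).add
      (((hasDerivAt_log_one_add (by linarith [hy.1])).pow 2).div_const 2)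
    refine hd.congr_deriv ?_
    rw [show 1 - y / (1 + y) = (1 + y)⁻¹ by field_simp; ring, log_inv]
    field_simp
    ring
  · simpa using ((tendsto_Li_comp_nhdsGT_zero le_rfl (g := fun y => y / (1 + y))
      (ContinuousAt.div (by fun_prop) (by fun_prop) (by simp)) (by simp)).add
      (tendsto_Li_comp_nhdsGT_zero le_rfl (g := fun y => -y) (by fun_prop) (by simp))).add
      ((tendsto_log_one_add_nhdsGT_zero.pow 2).div_const 2)

theorem hasDerivAt_integral_arctan_mul {s g : ℝ → ℝ} (hs : Continuous s) (hg : Continuous g)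
    (a b v : ℝ) :
    HasDerivAt (fun w => ∫ x in a..b, arctan (w * s x) * g x)
      (∫ x in a..b, s x / (1 + (v * s x) ^ 2) * g x) v := by
  have hden (w x : ℝ) : 1 + (w * s x) ^ 2 ≠ 0 := by positivity
  refine (intervalIntegral.hasDerivAt_integral_of_dominated_loc_of_deriv_le
    (F := fun w x => arctan (w * s x) * g x)
    (F' := fun w x => s x / (1 + (w * s x) ^ 2) * g x)
    (bound := fun x => |s x| * |g x|) univ_mem ?_ ?_ ?_ ?_ ?_ ?_).2
  · refine Eventually.of_forall fun w => Continuous.aestronglyMeasurable ?_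
    exact (continuous_arctan.comp (continuous_const.mul hs)).mul hg
  · exact ((continuous_arctan.comp (continuous_const.mul hs)).mul hg).intervalIntegrable _ _
  · exact ((hs.div (by fun_prop) (hden v)).mul hg).aestronglyMeasurable
  · refine Eventually.of_forall fun x _ w _ => ?_
    rw [norm_mul, norm_div, Real.norm_eq_abs, Real.norm_eq_abs, Real.norm_eq_abs]
    gcongr
    refine div_le_self (abs_nonneg _) ?_
    rw [abs_of_pos (by positivity)]
    nlinarith [sq_nonneg (w * s x)]
  · exact (hs.abs.mul hg.abs).intervalIntegrable _ _
  · refine Eventually.of_forall fun x _ w _ => ?_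
    refine ((((hasDerivAt_id w).mul_const (s x)).arctan).mul_const (g x)).congr_deriv ?_
    simp only [id]
    ring

theorem continuous_dslope_zero {f : ℝ → ℝ} (hf : Continuous f) (hd : DifferentiableAt ℝ f 0) :
    Continuous (dslope f 0) := by
  rw [← continuousOn_univ, continuousOn_dslope univ_mem]
  exact ⟨hf.continuousOn, hd⟩

theorem dslope_zero_of_ne {f : ℝ → ℝ} (hf : f 0 = 0) {x : ℝ} (hx : x ≠ 0) :
    dslope f 0 x = f x / x := by
  rw [dslope_of_ne _ hx, slope_def_field, hf, sub_zero, sub_zero]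

theorem hasDerivAt_TS_one (v : ℝ) :
    HasDerivAt (fun w => TS w 1) (∫ x in (0 : ℝ)..1, arcsin x / (1 + (v * x) ^ 2)) v := by
  have hc : Continuous (dslope arcsin 0) :=
    continuous_dslope_zero continuous_arcsin (differentiableAt_arcsin.2 (by norm_num))
  have hTS : (fun w => TS w 1) =
      fun w => ∫ x in (0 : ℝ)..1, arctan (w * x) * dslope arcsin 0 x := by
    funext w
    refine intervalIntegral.integral_congr_uIoo fun x hx => ?_
    rw [uIoo_of_le zero_le_one] at hx
    simp only [one_mul, dslope_zero_of_ne arcsin_zero hx.1.ne', mul_div_assoc]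
  rw [hTS]
  refine (hasDerivAt_integral_arctan_mul continuous_id hc 0 1 v).congr_deriv ?_
  refine intervalIntegral.integral_congr_uIoo fun x hx => ?_
  rw [uIoo_of_le zero_le_one] at hx
  have hx0 : x ≠ 0 := hx.1.ne'
  simp only [id, dslope_zero_of_ne arcsin_zero hx0]
  field_simp

theorem hasDerivAt_integral_arctan_div (v : ℝ) :
    HasDerivAt (fun w => ∫ u in (0 : ℝ)..w, arctan u / u) (dslope arctan 0 v) v := by
  have hc : Continuous (dslope arctan 0) :=
    continuous_dslope_zero continuous_arctan (differentiableAt_arctan 0)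
  have heq : (fun w => ∫ u in (0 : ℝ)..w, arctan u / u) =
      fun w => ∫ u in (0 : ℝ)..w, dslope arctan 0 u := by
    funext w
    refine intervalIntegral.integral_congr_uIoo fun x hx => ?_
    have hx0 : x ≠ 0 := by
      rintro rfl
      rcases le_total 0 w with h | h <;> simp [h] at hx
    exact (dslope_zero_of_ne arctan_zero hx0).symm
  rw [heq]
  exact intervalIntegral.integral_hasDerivAt_right (hc.intervalIntegrable _ _)
    hc.stronglyMeasurable.stronglyMeasurableAtFilter hc.continuousAt

theorem integral_arcsin_div_one_add_sq {v : ℝ} (hv : v ≠ 0) :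
    ∫ x in (0 : ℝ)..1, arcsin x / (1 + (v * x) ^ 2) =
      (π / 2 * arctan v - ∫ θ in (0 : ℝ)..(π / 2), arctan (v * sin θ)) / v := by
  have hden (x : ℝ) : 1 + (v * x) ^ 2 ≠ 0 := by positivity
  have hcont : Continuous fun x => arcsin x / (1 + (v * x) ^ 2) :=
    continuous_arcsin.div (by fun_prop) hden
  have hsub := intervalIntegral.integral_comp_mul_deriv (a := 0) (b := π / 2)
    (fun x _ => hasDerivAt_sin x) continuous_cos.continuousOn hcont
  have hparts := intervalIntegral.integral_mul_deriv_eq_deriv_mul (a := 0) (b := π / 2)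
    (u := fun θ => θ) (u' := fun _ => 1) (v := fun θ => arctan (v * sin θ) / v)
    (v' := fun θ => cos θ / (1 + (v * sin θ) ^ 2))
    (fun θ _ => hasDerivAt_id θ)
    (fun θ _ => by
      refine ((((hasDerivAt_sin θ).const_mul v).arctan).div_const v).congr_deriv ?_
      have := hden (sin θ)
      field_simp)
    (by simp)
    ((continuous_cos.div (by fun_prop) fun θ => hden (sin θ)).intervalIntegrable _ _)
  rw [sin_zero, sin_pi_div_two] at hsub
  rw [← hsub]
  have hcongr : ∫ θ in (0 : ℝ)..(π / 2),
      ((fun x => arcsin x / (1 + (v * x) ^ 2)) ∘ sin) θ * cos θ =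
      ∫ θ in (0 : ℝ)..(π / 2), θ * (cos θ / (1 + (v * sin θ) ^ 2)) := by
    refine intervalIntegral.integral_congr fun θ hθ => ?_
    rw [uIcc_of_le (by positivity)] at hθ
    simp only [Function.comp_apply]
    rw [arcsin_sin (by linarith [hθ.1, pi_pos]) hθ.2]
    ring
  rw [hcongr, hparts]
  simp only [one_mul, intervalIntegral.integral_div, sin_pi_div_two, sin_zero, mul_one, mul_zero,
    zero_mul]
  ring

theorem hasDerivAt_two_mul_div_one_sub_sq {r : ℝ} (hr : r ∈ Ioo (0 : ℝ) 1) :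
    HasDerivAt (fun s : ℝ => 2 * s / (1 - s ^ 2)) (2 * (1 + r ^ 2) / (1 - r ^ 2) ^ 2) r := by
  have h : 1 - r ^ 2 ≠ 0 := by nlinarith [hr.1, hr.2]
  refine (((hasDerivAt_id r).const_mul 2).div ((hasDerivAt_pow 2 r).const_sub 1) h).congr_deriv ?_
  simp
  ring

theorem integral_sin_div_one_add_sq {r : ℝ} (hr : r ∈ Ioo (0 : ℝ) 1) :
    ∫ θ in (0 : ℝ)..(π / 2), sin θ / (1 + (2 * r / (1 - r ^ 2) * sin θ) ^ 2) =
      (1 - r ^ 2) ^ 2 / (2 * r * (1 + r ^ 2)) * log ((1 + r) / (1 - r)) := by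
  obtain ⟨h0, h1⟩ := hr
  have hq : 0 < 1 - r ^ 2 := by nlinarith
  have hpos (θ : ℝ) : 0 < 1 + r ^ 2 + 2 * r * cos θ := by
    nlinarith [neg_one_le_cos θ, sq_pos_of_pos (sub_pos.2 h1)]
  have hneg (θ : ℝ) : 0 < 1 + r ^ 2 - 2 * r * cos θ := by
    nlinarith [cos_le_one θ, sq_pos_of_pos (sub_pos.2 h1)]
  have hden (θ : ℝ) : 0 < 1 + (2 * r / (1 - r ^ 2) * sin θ) ^ 2 := by positivity
  rw [intervalIntegral.integral_eq_sub_of_hasDerivAt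
    (f' := fun θ => sin θ / (1 + (2 * r / (1 - r ^ 2) * sin θ) ^ 2))
    (f := fun θ => -((1 - r ^ 2) ^ 2 / (4 * r * (1 + r ^ 2))) *
      (log (1 + r ^ 2 + 2 * r * cos θ) - log (1 + r ^ 2 - 2 * r * cos θ)))
    (fun θ _ => ?_)
    ((continuous_sin.div (by fun_prop) fun θ => (hden θ).ne').intervalIntegrable _ _)]
  · have e1 : 1 + r ^ 2 + 2 * r * 1 = (1 + r) ^ 2 := by ring
    have e2 : 1 + r ^ 2 - 2 * r * 1 = (1 - r) ^ 2 := by ring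
    simp only [cos_pi_div_two, cos_zero, mul_zero, e1, e2, log_pow, add_zero, sub_zero, sub_self]
    rw [log_div (by linarith) (by linarith)]
    field_simp
    ring
  · have hd := ((((hasDerivAt_cos θ).const_mul (2 * r)).const_add (1 + r ^ 2)).log (hpos θ).ne').sub
      ((((hasDerivAt_cos θ).const_mul (2 * r)).const_sub (1 + r ^ 2)).log (hneg θ).ne')
    refine (hd.const_mul (-((1 - r ^ 2) ^ 2 / (4 * r * (1 + r ^ 2))))).congr_deriv ?_
    have hprod : 1 + (2 * r / (1 - r ^ 2) * sin θ) ^ 2 =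
        (1 + r ^ 2 + 2 * r * cos θ) * (1 + r ^ 2 - 2 * r * cos θ) / (1 - r ^ 2) ^ 2 := by
      rw [mul_pow, sin_sq]
      field_simp
      ring
    rw [hprod]
    have hP := (hpos θ).ne'
    have hQ := (hneg θ).ne'
    have hsum : (1 + r ^ 2 + 2 * r * cos θ) + (1 + r ^ 2 - 2 * r * cos θ) = 2 * (1 + r ^ 2) := by
      ring
    have hK : 1 + r ^ 2 ≠ 0 := by positivity
    generalize 1 + r ^ 2 + 2 * r * cos θ = P at *
    generalize 1 + r ^ 2 - 2 * r * cos θ = Q at *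
    generalize 1 + r ^ 2 = K at *
    field_simp
    linear_combination 2 * sin θ * hsum

theorem tendsto_two_mul_div_one_sub_sq :
    Tendsto (fun s : ℝ => 2 * s / (1 - s ^ 2)) (𝓝[>] 0) (𝓝 0) := by
  have h : ContinuousAt (fun s : ℝ => 2 * s / (1 - s ^ 2)) 0 :=
    ContinuousAt.div (by fun_prop) (by fun_prop) (by norm_num)
  simpa using h.tendsto.mono_left (nhdsWithin_le_nhds (s := Ioi 0))

theorem integral_arctan_mul_sin {r : ℝ} (hr : r ∈ Ioo (0 : ℝ) 1) :
    ∫ θ in (0 : ℝ)..(π / 2), arctan (2 * r / (1 - r ^ 2) * sin θ) = Li 2 r - Li 2 (-r) := by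
  have hJ (v : ℝ) : HasDerivAt (fun w => ∫ θ in (0 : ℝ)..(π / 2), arctan (w * sin θ))
      (∫ θ in (0 : ℝ)..(π / 2), sin θ / (1 + (v * sin θ) ^ 2)) v := by
    simpa using hasDerivAt_integral_arctan_mul continuous_sin (continuous_const (y := (1 : ℝ)))
      0 (π / 2) v
  refine sub_eq_zero.1 (eq_of_hasDerivAt_zero_of_tendsto
    (f := fun s => (∫ θ in (0 : ℝ)..(π / 2), arctan (2 * s / (1 - s ^ 2) * sin θ)) -
      (Li 2 s - Li 2 (-s))) (fun s hs => ?_) ?_ hr)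
  · have hs0 : s ≠ 0 := hs.1.ne'
    have hs1 : |s| < 1 := by rw [abs_of_pos hs.1]; exact hs.2
    have hq : 1 - s ^ 2 ≠ 0 := by nlinarith [hs.1, hs.2]
    have hd := ((hJ _).comp s (hasDerivAt_two_mul_div_one_sub_sq hs)).sub
      ((hasDerivAt_Li_two hs1 hs0).sub (hasDerivAt_Li_two_neg hs))
    refine hd.congr_deriv ?_
    rw [integral_sin_div_one_add_sq hs, log_div (by linarith [hs.1]) (by linarith [hs.2])]
    field_simp
    ring
  · have hJ0 := ((hJ 0).continuousAt.tendsto).comp tendsto_two_mul_div_one_sub_sq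
    simpa [Function.comp_def] using hJ0.sub
      ((tendsto_Li_comp_nhdsGT_zero le_rfl (g := fun y => y) (by fun_prop) rfl).sub
      (tendsto_Li_comp_nhdsGT_zero le_rfl (g := fun y => -y) (by fun_prop) (by simp)))

/-- The polylogarithmic part of the closed form, up to sign. -/
noncomputable def polylogPart (r : ℝ) : ℝ :=
  (1 / 4) * Li 3 (r ^ 2) + 2 * Li 3 (1 - r) + 2 * Li 3 (r / (1 + r)) - 2 * Li 3 1
    - (1 / 2) * ((log (1 + r) - log (1 - r)) * Li 2 (r ^ 2))
    - (π ^ 2 / 3) * log (1 - r) - (1 / 3) * log (1 + r) ^ 3 + log r * log (1 - r) ^ 2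

theorem hasDerivAt_polylogPart {r : ℝ} (hr : r ∈ Ioo (0 : ℝ) 1) :
    HasDerivAt polylogPart
      ((Li 2 r - Li 2 (-r)) * ((1 + r ^ 2) / (r * (1 - r ^ 2)))) r := by
  have hr0 : r ≠ 0 := hr.1.ne'
  have hr1 : |r ^ 2| < 1 := by
    rw [abs_pow, abs_of_pos hr.1]; exact pow_lt_one₀ hr.1.le hr.2 two_ne_zero
  have hm : 1 - r ≠ 0 := by linarith [hr.2]
  have hp : 1 + r ≠ 0 := by linarith [hr.1]
  have hq : 1 - r ^ 2 ≠ 0 := by nlinarith [hr.1, hr.2]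
  have hm1 : |1 - r| < 1 := abs_lt.2 ⟨by linarith [hr.2], by linarith [hr.1]⟩
  have d1 := (hasDerivAt_Li_succ 2 hr1 (by positivity)).comp (h := fun s => s ^ 2) r
    (hasDerivAt_pow 2 r)
  have d2 := (hasDerivAt_Li_succ 2 hm1 hm).comp r ((hasDerivAt_id r).const_sub 1)
  have d3 := (hasDerivAt_Li_succ 2 (abs_div_one_add_lt_one hr.1) (div_ne_zero hr0 hp)).comp r
    (hasDerivAt_div_one_add hp)
  have dm := hasDerivAt_log_one_sub hr.2
  have dp := hasDerivAt_log_one_add (by linarith [hr.1] : -1 < r)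
  have d := (((((((d1.const_mul (1 / 4)).add (d2.const_mul 2)).add (d3.const_mul 2)).sub_const
    (2 * Li 3 1)).sub (((dp.sub dm).mul (hasDerivAt_Li_two_sq hr)).const_mul (1 / 2))).sub
    (dm.const_mul (π ^ 2 / 3))).sub ((dp.pow 3).const_mul (1 / 3))).add
    ((hasDerivAt_log hr0).mul (dm.pow 2))
  refine d.congr_deriv ?_
  simp only [Pi.pow_apply, Pi.sub_apply]
  rw [Li_two_one_sub hr, Li_two_div_one_add hr, Li_two_sq hr]
  generalize Li 2 r = A
  generalize Li 2 (-r) = B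
  generalize log (1 - r) = q
  generalize log (1 + r) = p
  generalize log r = l
  rw [show 1 - r ^ 2 = (1 - r) * (1 + r) by ring]
  push_cast
  field_simp
  ring

theorem tendsto_polylogPart_nhdsGT_zero : Tendsto polylogPart (𝓝[>] 0) (𝓝 0) := by
  have t1 (k : ℕ) (hk : 2 ≤ k) := tendsto_Li_comp_nhdsGT_zero hk
    (g := fun y => y ^ 2) (by fun_prop) (by simp)
  have t2 := tendsto_Li_comp_nhdsGT_zero (show 2 ≤ 3 by norm_num) (g := fun y => y / (1 + y))
    (ContinuousAt.div (by fun_prop) (by fun_prop) (by simp)) (by simp)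
  have t3 := tendsto_Li_one_sub_nhdsGT_zero (show 2 ≤ 3 by norm_num)
  have tm := tendsto_log_one_sub_nhdsGT_zero
  have tp := tendsto_log_one_add_nhdsGT_zero
  have t := ((((((((t1 3 (by norm_num)).const_mul (1 / 4)).add (t3.const_mul 2)).add
    (t2.const_mul 2)).sub_const (2 * Li 3 1)).sub
    (((tp.sub tm).mul (t1 2 le_rfl)).const_mul (1 / 2))).sub
    (tm.const_mul (π ^ 2 / 3))).sub ((tp.pow 3).const_mul (1 / 3))).add
    (tendsto_log_mul_log_one_sub_nhdsGT_zero.mul tm)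
  refine (t.congr fun r => ?_).trans_eq ?_
  · rw [polylogPart]
    ring
  · norm_num

theorem TS_one_eq_sub_polylogPart {r : ℝ} (hr : r ∈ Ioo (0 : ℝ) 1) :
    TS (2 * r / (1 - r ^ 2)) 1 =
      π / 2 * (∫ u in (0 : ℝ)..(2 * r / (1 - r ^ 2)), arctan u / u) - polylogPart r := by
  have key := eq_of_hasDerivAt_zero_of_tendsto (c := 0)
    (f := fun s => TS (2 * s / (1 - s ^ 2)) 1 -
      π / 2 * (∫ u in (0 : ℝ)..(2 * s / (1 - s ^ 2)), arctan u / u) + polylogPart s)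
    (fun s hs => ?_) ?_ hr
  · linarith
  · have hs0 : s ≠ 0 := hs.1.ne'
    have hq : 0 < 1 - s ^ 2 := by nlinarith [hs.1, hs.2]
    have hv : 2 * s / (1 - s ^ 2) ≠ 0 := by positivity
    have hg := hasDerivAt_two_mul_div_one_sub_sq hs
    have hd := (((hasDerivAt_TS_one _).comp s hg).sub
      (((hasDerivAt_integral_arctan_div _).comp s hg).const_mul (π / 2))).add
      (hasDerivAt_polylogPart hs)
    refine hd.congr_deriv ?_
    rw [integral_arcsin_div_one_add_sq hv, integral_arctan_mul_sin hs,
      dslope_zero_of_ne arctan_zero hv]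
    generalize arctan _ = a
    field_simp
    ring
  · have h1 := (hasDerivAt_TS_one 0).continuousAt.tendsto.comp tendsto_two_mul_div_one_sub_sq
    have h2 := (hasDerivAt_integral_arctan_div 0).continuousAt.tendsto.comp
      tendsto_two_mul_div_one_sub_sq
    have hTS : TS 0 1 = 0 := by simp [TS]
    simpa [Function.comp_def, hTS] using
      (h1.sub (h2.const_mul (π / 2))).add tendsto_polylogPart_nhdsGT_zero

theorem TS_v_one_closed_form (v : ℝ) (hv : 0 < v)
    (r : ℝ) (hr : r = v / (1 + Real.sqrt (1 + v ^ 2))) :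
    TS v 1 =
      (Real.pi / 2) * (∫ u in (0:ℝ)..v, Real.arctan u / u)
        - (1 / 4) * Li 3 (r ^ 2) - 2 * Li 3 (1 - r) - 2 * Li 3 (r / (1 + r))
        + 2 * (∑' n : ℕ, 1 / ((n : ℝ) + 1) ^ 3)
        + (1 / 2) * Real.log ((1 + r) / (1 - r)) * Li 2 (r ^ 2)
        + (Real.pi ^ 2 / 3) * Real.log (1 - r)
        + (1 / 3) * (Real.log (1 + r)) ^ 3
        - Real.log r * (Real.log (1 - r)) ^ 2 := by
  have hs : √(1 + v ^ 2) ^ 2 = 1 + v ^ 2 := sq_sqrt (by positivity)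
  have hs0 : 0 ≤ √(1 + v ^ 2) := sqrt_nonneg _
  have hvs : v < 1 + √(1 + v ^ 2) := by nlinarith
  have hr' : r ∈ Ioo (0 : ℝ) 1 := by
    rw [hr]
    exact ⟨by positivity, (div_lt_one (by positivity)).2 hvs⟩
  have hrv : v = 2 * r / (1 - r ^ 2) := by
    rw [eq_div_iff (by nlinarith [hr'.1, hr'.2]), hr]
    field_simp
    linear_combination hs
  have hζ : ∑' n : ℕ, 1 / ((n : ℝ) + 1) ^ 3 = Li 3 1 := by simp [Li]
  have key := TS_one_eq_sub_polylogPart hr'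
  rw [← hrv, polylogPart] at key
  rw [key, hζ, log_div (by linarith [hr'.1]) (by linarith [hr'.2])]
  ring
end

section
/- For every real number v with 0 ≤ v ≤ 1, S(v,1) = (π/2) ∫₀ᵛ (arcsin u)/u du − (Li₃(v) − Li₃(−v))/2; that is, ∫₀¹ arcsin(vx)·arcsin(x)/x dx = (π/2)∫₀ᵛ (arcsin u)/u du − (1/2)(∑_{n=1}^∞ vⁿ/n³ − ∑_{n=1}^∞ (−v)ⁿ/n³). -/
open Real MeasureTheory intervalIntegral

/-- The trilogarithm `Li₃(z) = ∑_{n≥1} zⁿ/n³` (real). -/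
noncomputable def Li3 (z : ℝ) : ℝ := ∑' n : ℕ, z ^ (n + 1) / ((n + 1 : ℕ) : ℝ) ^ 3

theorem centralBinom_succ_div_four_pow (n : ℕ) :
    (Nat.centralBinom (n + 1) : ℝ) / 4 ^ (n + 1) =
      (2 * n + 1) / (2 * n + 2) * (Nat.centralBinom n / 4 ^ n) := by
  have h : ((n : ℝ) + 1) * Nat.centralBinom (n + 1) = 2 * (2 * n + 1) * Nat.centralBinom n := by
    exact_mod_cast Nat.succ_mul_centralBinom_succ n
  have h' : (Nat.centralBinom (n + 1) : ℝ) =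
      2 * (2 * n + 1) * Nat.centralBinom n / (n + 1) := by
    rw [eq_div_iff (by positivity), mul_comm, h]
  rw [h']
  field_simp
  ring

theorem ring_multichoose_half (n : ℕ) :
    Ring.multichoose (1 / 2 : ℝ) n = Nat.centralBinom n / 4 ^ n := by
  have h (m : ℕ) : (m.factorial : ℝ) * Ring.multichoose (1 / 2 : ℝ) m =
      (ascPochhammer ℝ m).eval (1 / 2) := by
    rw [← nsmul_eq_mul, Ring.factorial_nsmul_multichoose_eq_ascPochhammer,
      Polynomial.ascPochhammer_smeval_eq_eval]
  induction n with
  | zero => simp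
  | succ n ih =>
    have h₁ := h (n + 1)
    rw [ascPochhammer_succ_eval, ← h n, ih, Nat.factorial_succ] at h₁
    have hn : (n.factorial : ℝ) ≠ 0 := by positivity
    push_cast at h₁
    rw [centralBinom_succ_div_four_pow]
    have h₂ : ((n : ℝ) + 1) * Ring.multichoose (1 / 2 : ℝ) (n + 1) =
        Nat.centralBinom n / 4 ^ n * (1 / 2 + n) := by
      apply mul_left_cancel₀ hn
      linarith
    rw [mul_comm, ← eq_div_iff (by positivity)] at h₂
    rw [h₂]
    field_simp
    ring

theorem hasSum_centralBinom_div_four_pow_mul_pow {t : ℝ} (ht : |t| < 1) :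
    HasSum (fun n : ℕ ↦ (Nat.centralBinom n / 4 ^ n : ℝ) * t ^ n) (1 / √(1 - t)) := by
  have h := (Real.one_div_one_sub_rpow_hasFPowerSeriesOnBall_zero (1 / 2)).hasSum (y := t)
    (by simpa [enorm_eq_nnnorm, ← NNReal.coe_lt_coe] using ht)
  rw [zero_add, ← Real.sqrt_eq_rpow] at h
  convert! h using 2 with n
  rw [FormalMultilinearSeries.ofScalars_apply_eq, ← Ring.multichoose_eq, ring_multichoose_half,
    smul_eq_mul]

theorem hasSum_arcsin {y : ℝ} (hy0 : 0 ≤ y) (hy1 : y < 1) :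
    HasSum (fun n : ℕ ↦ (Nat.centralBinom n / 4 ^ n : ℝ) * (y ^ (2 * n + 1) / (2 * n + 1)))
      (arcsin y) := by
  have hsum : ∀ s ∈ Set.Icc 0 y,
      HasSum (fun n : ℕ ↦ (Nat.centralBinom n / 4 ^ n : ℝ) * s ^ (2 * n)) (1 / √(1 - s ^ 2)) := by
    intro s hs
    have hs1 : |s ^ 2| < 1 := by
      rw [abs_of_nonneg (by positivity)]
      nlinarith [hs.1, hs.2]
    simpa only [pow_mul] using hasSum_centralBinom_div_four_pow_mul_pow hs1
  have key := intervalIntegral.hasSum_integral_of_dominated_convergence (μ := volume)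
    (a := 0) (b := y) (F := fun (n : ℕ) s ↦ (Nat.centralBinom n / 4 ^ n : ℝ) * s ^ (2 * n))
    (f := fun s ↦ 1 / √(1 - s ^ 2))
    (fun n _ ↦ (Nat.centralBinom n / 4 ^ n : ℝ) * y ^ (2 * n))
    (fun n ↦ by fun_prop)
    (fun n ↦ .of_forall fun s hs ↦ by
      rw [Set.uIoc_of_le hy0] at hs
      have := hs.1
      rw [norm_of_nonneg (by positivity)]
      gcongr
      exact hs.2)
    (.of_forall fun _ _ ↦ (hsum y ⟨hy0, le_rfl⟩).summable)
    (by simp)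
    (.of_forall fun s hs ↦ by
      rw [Set.uIoc_of_le hy0] at hs
      exact hsum s ⟨hs.1.le, hs.2⟩)
  have hint : ∫ s in (0 : ℝ)..y, 1 / √(1 - s ^ 2) = arcsin y := by
    rw [integral_eq_sub_of_hasDerivAt (f := arcsin), arcsin_zero, sub_zero]
    · intro s hs
      rw [Set.uIcc_of_le hy0] at hs
      exact hasDerivAt_arcsin (by linarith [hs.1]) (by linarith [hs.2])
    · refine ContinuousOn.intervalIntegrable fun s hs ↦ ?_
      rw [Set.uIcc_of_le hy0] at hs
      have : √(1 - s ^ 2) ≠ 0 := (Real.sqrt_pos.2 (by nlinarith [hs.1, hs.2])).ne'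
      exact ContinuousAt.continuousWithinAt (by fun_prop (disch := assumption))
  rw [hint] at key
  convert! key using 2 with n
  rw [intervalIntegral.integral_const_mul, integral_pow]
  simp

theorem integral_cos_pow_odd_zero_pi_div_two (n : ℕ) :
    (Nat.centralBinom n / 4 ^ n : ℝ) * ∫ t in (0 : ℝ)..π / 2, cos t ^ (2 * n + 1) =
      1 / (2 * n + 1) := by
  induction n with
  | zero => simp
  | succ n ih =>
    have h := integral_cos_pow (a := 0) (b := π / 2) (2 * n + 1)
    rw [show 2 * (n + 1) + 1 = 2 * n + 1 + 2 by ring, h, centralBinom_succ_div_four_pow]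
    simp only [cos_pi_div_two, sin_zero, mul_zero, sub_zero, ne_eq, Nat.add_eq_zero_iff,
      one_ne_zero, and_false, not_false_eq_true, zero_pow, zero_mul, zero_div, zero_add]
    rw [mul_mul_mul_comm, ih]
    push_cast
    field_simp
    ring

theorem integral_pow_even_mul_arccos (n : ℕ) :
    (Nat.centralBinom n / 4 ^ n : ℝ) * ∫ x in (0 : ℝ)..1, x ^ (2 * n) * arccos x =
      1 / (2 * n + 1) ^ 2 := by
  have hsubst := integral_comp_mul_deriv (a := 0) (b := π / 2) (f := cos) (f' := fun t ↦ -sin t)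
    (g := fun x ↦ x ^ (2 * n) * arccos x) (fun t _ ↦ hasDerivAt_cos t) (by fun_prop)
    (by fun_prop)
  have hparts := integral_mul_deriv_eq_deriv_mul (a := 0) (b := π / 2) (u := fun t ↦ t)
    (u' := fun _ ↦ 1) (v := fun t ↦ cos t ^ (2 * n + 1))
    (v' := fun t ↦ ((2 * n + 1 : ℕ) : ℝ) * cos t ^ (2 * n) * (-sin t)) (fun t _ ↦ hasDerivAt_id t)
    (fun t _ ↦ (hasDerivAt_cos t).pow (2 * n + 1))
    (by simp) (Continuous.intervalIntegrable (by fun_prop) _ _)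
  have hcongr : ∫ t in (0 : ℝ)..π / 2, t * (((2 * n + 1 : ℕ) : ℝ) * cos t ^ (2 * n) * (-sin t)) =
      (2 * n + 1) * ∫ t in (0 : ℝ)..π / 2,
        ((fun x ↦ x ^ (2 * n) * arccos x) ∘ cos) t * (-sin t) := by
    rw [← intervalIntegral.integral_const_mul]
    refine integral_congr fun t ht ↦ ?_
    rw [Set.uIcc_of_le (by positivity)] at ht
    simp only [Function.comp_apply]
    rw [arccos_cos ht.1 (by linarith [ht.2, pi_pos])]
    push_cast
    ring
  rw [hcongr, hsubst, cos_zero, cos_pi_div_two, integral_symm] at hparts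
  have hcos := integral_cos_pow_odd_zero_pi_div_two n
  have hJ : ∫ x in (0 : ℝ)..1, x ^ (2 * n) * arccos x =
      (∫ t in (0 : ℝ)..π / 2, cos t ^ (2 * n + 1)) / (2 * n + 1) := by
    rw [eq_div_iff (by positivity)]
    simp only [one_mul, ne_eq, Nat.add_eq_zero_iff, one_ne_zero, and_false, not_false_eq_true,
      zero_pow, mul_zero, zero_mul, sub_zero, zero_sub] at hparts
    linarith
  rw [hJ, mul_div_assoc', hcos]
  field_simp

theorem summable_pow_succ_div_cube {z : ℝ} (hz : |z| ≤ 1) :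
    Summable fun n : ℕ ↦ z ^ (n + 1) / ((n + 1 : ℕ) : ℝ) ^ 3 := by
  have h := (summable_nat_add_iff 1).2 (Real.summable_one_div_nat_pow (p := 3).2 (by norm_num))
  refine h.of_norm_bounded fun n ↦ ?_
  rw [norm_div, norm_pow, norm_pow, Real.norm_natCast, Real.norm_eq_abs]
  gcongr
  exact pow_le_one₀ (abs_nonneg z) hz

theorem hasSum_Li3_sub_Li3_neg {v : ℝ} (hv : |v| ≤ 1) :
    HasSum (fun n : ℕ ↦ v ^ (2 * n + 1) / (2 * n + 1 : ℝ) ^ 3) ((Li3 v - Li3 (-v)) / 2) := by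
  have hsub := ((summable_pow_succ_div_cube hv).hasSum.sub
    (summable_pow_succ_div_cube (z := -v) (by simpa using hv)).hasSum).div_const 2
  refine (hasSum_iff_hasSum_of_ne_zero_bij (fun n ↦ 2 * (n : ℕ)) ?_ ?_ ?_).1 hsub
  · intro a b h
    simpa [Subtype.ext_iff] using h
  · intro m hm
    obtain ⟨k, rfl | rfl⟩ := Nat.even_or_odd' m
    · refine ⟨⟨k, fun h ↦ hm ?_⟩, rfl⟩
      have h2 : (-v) ^ (2 * k + 1) = -v ^ (2 * k + 1) := Odd.neg_pow ⟨k, rfl⟩ v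
      push_cast
      beta_reduce at h
      rw [h2, neg_div, h]
      simp
    · refine absurd ?_ hm
      have h2 : (-v) ^ (2 * k + 1 + 1) = v ^ (2 * k + 1 + 1) := Even.neg_pow ⟨k + 1, by ring⟩ v
      simp [h2]
  · rintro ⟨k, -⟩
    have h2 : (-v) ^ (2 * k + 1) = -v ^ (2 * k + 1) := Odd.neg_pow ⟨k, rfl⟩ v
    simp only [h2]
    push_cast
    ring

theorem arcsin_le_pi_div_two_mul {y : ℝ} (hy0 : 0 ≤ y) (hy1 : y ≤ 1) : arcsin y ≤ π / 2 * y := by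
  have h := mul_le_sin (arcsin_nonneg.2 hy0) (arcsin_le_pi_div_two y)
  rw [sin_arcsin (by linarith) hy1] at h
  calc arcsin y = π / 2 * (2 / π * arcsin y) := by field_simp
    _ ≤ π / 2 * y := by gcongr

theorem intervalIntegrable_arcsin_mul_div {v : ℝ} (hv0 : 0 ≤ v) (hv1 : v ≤ 1) :
    IntervalIntegrable (fun x ↦ arcsin (v * x) / x) volume 0 1 := by
  rw [intervalIntegrable_iff_integrableOn_Ioc_of_le zero_le_one]
  refine Measure.integrableOn_of_bounded (M := π / 2 * v) (by simp)
    (Measurable.aestronglyMeasurable (by fun_prop)) ?_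
  filter_upwards [ae_restrict_mem measurableSet_Ioc] with x hx
  have hx0 := hx.1
  rw [norm_of_nonneg (div_nonneg (arcsin_nonneg.2 (by positivity)) hx0.le), div_le_iff₀ hx0,
    mul_assoc]
  exact arcsin_le_pi_div_two_mul (by positivity) (mul_le_one₀ hv1 hx0.le hx.2)

theorem integral_arcsin_mul_div {v : ℝ} (hv0 : 0 ≤ v) :
    ∫ x in (0 : ℝ)..1, arcsin (v * x) / x = ∫ u in (0 : ℝ)..v, arcsin u / u := by
  rcases hv0.eq_or_lt with rfl | hv
  · simp
  · have h := intervalIntegral.mul_integral_comp_mul_left (a := 0) (b := 1)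
      (f := fun u ↦ arcsin u / u) v
    rw [mul_zero, mul_one, ← intervalIntegral.integral_const_mul] at h
    rw [← h]
    congr 1 with x
    field_simp

theorem hasSum_integral_arcsin_mul_arccos_div {v : ℝ} (hv0 : 0 ≤ v) (hv1 : v ≤ 1) :
    HasSum (fun n : ℕ ↦ v ^ (2 * n + 1) / (2 * n + 1 : ℝ) ^ 3)
      (∫ x in (0 : ℝ)..1, arcsin (v * x) / x * arccos x) := by
  set F : ℕ → ℝ → ℝ := fun n x ↦ v ^ (2 * n + 1) / (2 * n + 1) *
    ((Nat.centralBinom n / 4 ^ n : ℝ) * (x ^ (2 * n) * arccos x)) with hF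
  have hFint (n : ℕ) : ∫ x in Set.Ioc (0 : ℝ) 1, F n x = v ^ (2 * n + 1) / (2 * n + 1 : ℝ) ^ 3 := by
    rw [← integral_of_le zero_le_one, intervalIntegral.integral_const_mul,
      intervalIntegral.integral_const_mul, integral_pow_even_mul_arccos]
    field_simp
  have hFnonneg (n : ℕ) (x : ℝ) : 0 ≤ F n x := by
    have := arccos_nonneg x
    have := (even_two_mul n).pow_nonneg x
    positivity
  have hv : |v| ≤ 1 := by rwa [abs_of_nonneg hv0]
  have key := hasSum_integral_of_summable_integral_norm
    (μ := volume.restrict (Set.Ioc (0 : ℝ) 1)) (F := F)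
    (fun n ↦ (Continuous.integrableOn_Ioc (by fun_prop)))
    (by simpa only [norm_of_nonneg (hFnonneg _ _), hFint] using (hasSum_Li3_sub_Li3_neg hv).summable)
  simp only [hFint] at key
  convert! key using 1
  rw [integral_of_le zero_le_one, integral_Ioc_eq_integral_Ioo, integral_Ioc_eq_integral_Ioo]
  refine setIntegral_congr_fun measurableSet_Ioo fun x hx ↦ ?_
  have hx0 := hx.1
  have h := ((hasSum_arcsin (y := v * x) (by positivity)
    (by nlinarith [hx.2])).div_const x).mul_right (arccos x)
  rw [← h.tsum_eq]
  refine tsum_congr fun n ↦ ?_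
  simp only [hF]
  field_simp
  ring

theorem S_v_one_closed_form (v : ℝ) (hv0 : 0 ≤ v) (hv1 : v ≤ 1) :
    (∫ x in (0:ℝ)..1, Real.arcsin (v * x) * Real.arcsin x / x) =
      (Real.pi / 2) * (∫ u in (0:ℝ)..v, Real.arcsin u / u)
        - (Li3 v - Li3 (-v)) / 2 := by
  have hint := intervalIntegrable_arcsin_mul_div hv0 hv1
  rw [← integral_arcsin_mul_div hv0,
    (hasSum_Li3_sub_Li3_neg (by rwa [abs_of_nonneg hv0])).unique
      (hasSum_integral_arcsin_mul_arccos_div hv0 hv1),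
    ← intervalIntegral.integral_const_mul, ← intervalIntegral.integral_sub (hint.const_mul _)
      (hint.mul_continuousOn (by fun_prop))]
  congr 1 with x
  rw [arccos]
  ring
end

section
/- Let v, w be real numbers with 0 ≤ v < w ≤ 1 and set θ = arcsin(w) − arcsin(v). Then 2·S(v,w) = S(v,v) + S(w,w) − S(sin θ, sin θ) − 2·Li₃(v/w) + Li₃((v/w)e^{iθ}) + Li₃((v/w)e^{−iθ}) − iθ·Li₂((v/w)e^{iθ}) + iθ·Li₂((v/w)e^{−iθ}) + (θ²/2)·log(1 + v²/w² − 2(v/w)cos θ), where the real quantities are regarded as complex numbers. -/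
open Real MeasureTheory intervalIntegral

/-- `S(v,w) = ∫₀¹ arcsin(vx) arcsin(wx) / x dx` -/
noncomputable def S (v w : ℝ) : ℝ :=
  ∫ x in (0:ℝ)..1, Real.arcsin (v * x) * Real.arcsin (w * x) / x

/-- The complex dilogarithm `Li₂(z) = ∑_{n≥1} zⁿ/n²`. -/
noncomputable def Li2c (z : ℂ) : ℂ := ∑' n : ℕ, z ^ (n + 1) / ((n + 1 : ℕ) : ℂ) ^ 2

/-- The complex trilogarithm `Li₃(z) = ∑_{n≥1} zⁿ/n³`. -/
noncomputable def Li3c (z : ℂ) : ℂ := ∑' n : ℕ, z ^ (n + 1) / ((n + 1 : ℕ) : ℂ) ^ 3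

/-- The even continuous function `arcsin y / y`, with value `1` at `0`. -/
noncomputable def arcsinDiv : ℝ → ℝ := dslope Real.arcsin 0

theorem arcsinDiv_mul (y : ℝ) : arcsinDiv y * y = Real.arcsin y := by
  have := sub_smul_dslope Real.arcsin 0 y
  simp only [sub_zero, Real.arcsin_zero, smul_eq_mul] at this
  rw [arcsinDiv, mul_comm, this]

theorem continuous_arcsinDiv : Continuous arcsinDiv := by
  rw [continuous_iff_continuousAt]
  intro y
  rcases eq_or_ne y 0 with rfl | hy
  · exact continuousAt_dslope_same.2
      (Real.differentiableAt_arcsin.2 ⟨by norm_num, by norm_num⟩)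
  · exact (continuousAt_dslope_of_ne hy).2 Real.continuous_arcsin.continuousAt

theorem arcsin_mul_arcsin_div (v w x : ℝ) :
    Real.arcsin (v * x) * Real.arcsin (w * x) / x =
      v * arcsinDiv (v * x) * Real.arcsin (w * x) := by
  rcases eq_or_ne x 0 with rfl | hx
  · simp
  · rw [← arcsinDiv_mul (v * x)]
    field_simp

theorem intervalIntegrable_arcsin_mul_arcsin_div (v w a b : ℝ) :
    IntervalIntegrable (fun x => Real.arcsin (v * x) * Real.arcsin (w * x) / x) volume a b := by
  simp only [arcsin_mul_arcsin_div]
  refine Continuous.intervalIntegrable ?_ _ _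
  have := continuous_arcsinDiv
  fun_prop

theorem S_self_eq (a : ℝ) : S a a = ∫ u in (0 : ℝ)..a, arcsinDiv u * Real.arcsin u := by
  have := intervalIntegral.mul_integral_comp_mul_left (a := 0) (b := 1)
    (f := fun u => arcsinDiv u * Real.arcsin u) (c := a)
  simp only [mul_zero, mul_one] at this
  rw [← this, S, ← intervalIntegral.integral_const_mul]
  refine intervalIntegral.integral_congr fun x _ => ?_
  simp only [arcsin_mul_arcsin_div, mul_assoc]

theorem hasDerivAt_S_self (a : ℝ) :
    HasDerivAt (fun a => S a a) (arcsinDiv a * Real.arcsin a) a := by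
  simp only [S_self_eq]
  have h : Continuous fun u => arcsinDiv u * Real.arcsin u :=
    continuous_arcsinDiv.mul Real.continuous_arcsin
  exact h.integral_hasStrictDerivAt 0 a |>.hasDerivAt

theorem continuous_S_self : Continuous fun a => S a a :=
  continuous_iff_continuousAt.2 fun a => (hasDerivAt_S_self a).continuousAt

/-- Polarization: `2 α β = α² + β² - (β - α)²` with `α = arcsin (v x)`, `β = arcsin (w x)`. -/
theorem two_mul_S (v w : ℝ) :
    2 * S v w = S v v + S w w -
      ∫ x in (0 : ℝ)..1, (Real.arcsin (w * x) - Real.arcsin (v * x)) ^ 2 / x := by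
  have hvv := intervalIntegrable_arcsin_mul_arcsin_div v v 0 1
  have hww := intervalIntegrable_arcsin_mul_arcsin_div w w 0 1
  have hvw := intervalIntegrable_arcsin_mul_arcsin_div v w 0 1
  have : ∫ x in (0 : ℝ)..1, (Real.arcsin (w * x) - Real.arcsin (v * x)) ^ 2 / x =
      S v v + S w w - 2 * S v w := by
    simp only [S]
    rw [← intervalIntegral.integral_const_mul, ← intervalIntegral.integral_add hvv hww,
      ← intervalIntegral.integral_sub (hvv.add hww) (hvw.const_mul 2)]
    refine intervalIntegral.integral_congr fun x _ => ?_
    ring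
  rw [this]
  ring

theorem intervalIntegrable_arcsin_sub_sq_div (v w a b : ℝ) :
    IntervalIntegrable (fun x => (Real.arcsin (w * x) - Real.arcsin (v * x)) ^ 2 / x)
      volume a b := by
  refine (((intervalIntegrable_arcsin_mul_arcsin_div v v a b).add
    (intervalIntegrable_arcsin_mul_arcsin_div w w a b)).sub
    ((intervalIntegrable_arcsin_mul_arcsin_div v w a b).const_mul 2)).congr fun x _ => ?_
  ring

theorem one_add_sq_sub_two_mul_cos_pos {r : ℝ} (hr0 : 0 ≤ r) (hr1 : r < 1) (t : ℝ) :
    0 < 1 + r ^ 2 - 2 * r * Real.cos t := by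
  nlinarith [Real.cos_le_one t, mul_nonneg hr0 (sub_nonneg.2 (Real.cos_le_one t)),
    pow_pos (sub_pos.2 hr1) 2]

theorem hasSum_log_one_add_sq_sub_two_mul_cos {r : ℝ} (hr0 : 0 ≤ r) (hr1 : r < 1) (t : ℝ) :
    HasSum (fun n : ℕ => -2 * r ^ (n + 1) / (n + 1) * Real.cos ((n + 1) * t))
      (Real.log (1 + r ^ 2 - 2 * r * Real.cos t)) := by
  set z : ℂ := r * Complex.exp (t * Complex.I) with hz
  have hnorm : ‖z‖ < 1 := by
    rw [hz, norm_mul, Complex.norm_exp_ofReal_mul_I, Complex.norm_real, Real.norm_eq_abs,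
      abs_of_nonneg hr0, mul_one]
    exact hr1
  have h1 := (hasSum_nat_add_iff' 1).2 (Complex.hasSum_taylorSeries_neg_log hnorm)
  have h2 := (Complex.hasSum_re h1).mul_left (-2)
  have hsq : 1 + r ^ 2 - 2 * r * Real.cos t = ‖1 - z‖ ^ 2 := by
    rw [← Complex.normSq_eq_norm_sq, Complex.normSq_apply, hz]
    simp only [Complex.sub_re, Complex.sub_im, Complex.one_re, Complex.one_im,
      Complex.re_ofReal_mul, Complex.im_ofReal_mul, Complex.exp_ofReal_mul_I_re,
      Complex.exp_ofReal_mul_I_im]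
    linear_combination (-r ^ 2) * Real.sin_sq_add_cos_sq t
  have hval : Real.log (1 + r ^ 2 - 2 * r * Real.cos t) =
      -2 * (-Complex.log (1 - z) - ∑ i ∈ Finset.range 1, z ^ i / (i : ℂ)).re := by
    rw [hsq, Real.log_pow]
    simp [Complex.log_re]
  rw [hval]
  refine (congrArg (HasSum · _) (funext fun n => ?_)).mpr h2
  have : z ^ (n + 1) / ((n + 1 : ℕ) : ℂ) =
        ((r ^ (n + 1) / (n + 1) : ℝ) : ℂ) * Complex.exp ((((n + 1) * t : ℝ) : ℂ) * Complex.I) := by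
    rw [hz, mul_pow, ← Complex.exp_nat_mul]
    push_cast
    ring_nf
  rw [this, Complex.re_ofReal_mul, Complex.exp_ofReal_mul_I_re]
  ring

theorem integral_mul_cos {k : ℝ} (hk : k ≠ 0) (t : ℝ) :
    ∫ s in (0 : ℝ)..t, s * Real.cos (k * s) =
      t * Real.sin (k * t) / k + (Real.cos (k * t) - 1) / k ^ 2 := by
  have hd : ∀ s ∈ Set.uIcc 0 t, HasDerivAt
      (fun s => s * Real.sin (k * s) / k + (Real.cos (k * s) - 1) / k ^ 2)
      (s * Real.cos (k * s)) s := by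
    intro s _
    have hks : HasDerivAt (fun s : ℝ => k * s) k s := by
      simpa using (hasDerivAt_id s).const_mul k
    refine ((((hasDerivAt_id s).mul hks.sin).div_const k).add
      ((hks.cos.sub_const 1).div_const (k ^ 2))).congr_deriv ?_
    simp only [id]
    field_simp
    ring
  rw [intervalIntegral.integral_eq_sub_of_hasDerivAt hd
    (Continuous.intervalIntegrable (by fun_prop) _ _)]
  simp

theorem hasSum_integral_mul_log {r : ℝ} (hr0 : 0 ≤ r) (hr1 : r < 1) (t : ℝ) :
    HasSum (fun n : ℕ => -2 * r ^ (n + 1) / (n + 1) *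
        (t * Real.sin ((n + 1) * t) / (n + 1) + (Real.cos ((n + 1) * t) - 1) / (n + 1) ^ 2))
      (∫ s in (0 : ℝ)..t, s * Real.log (1 + r ^ 2 - 2 * r * Real.cos s)) := by
  have key := intervalIntegral.hasSum_integral_of_dominated_convergence (μ := volume)
    (a := 0) (b := t)
    (F := fun (n : ℕ) s => s * (-2 * r ^ (n + 1) / (n + 1) * Real.cos ((n + 1) * s)))
    (f := fun s => s * Real.log (1 + r ^ 2 - 2 * r * Real.cos s))
    (fun n _ => |t| * (2 * r ^ n))
    (fun n => (Continuous.aestronglyMeasurable (by fun_prop)))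
    (fun n => Filter.Eventually.of_forall fun s hs => ?_)
    (Filter.Eventually.of_forall fun s _ =>
      ((summable_geometric_of_lt_one hr0 hr1).mul_left 2).mul_left _)
    intervalIntegrable_const
    (Filter.Eventually.of_forall fun s _ =>
      (hasSum_log_one_add_sq_sub_two_mul_cos hr0 hr1 s).mul_left s)
  · refine (congrArg (HasSum · _) (funext fun n => ?_)).mpr key
    rw [← integral_mul_cos (by positivity), ← intervalIntegral.integral_const_mul]
    congr 1
    ext s
    ring
  · have hs' : |s| ≤ |t| := by
      rcases Set.mem_uIoc.1 hs with h | h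
      · rw [abs_of_pos h.1]; exact h.2.trans (le_abs_self t)
      · rw [abs_of_nonpos h.2, abs_of_nonpos (h.1.le.trans h.2)]; linarith
    rw [norm_mul, norm_mul, Real.norm_eq_abs, Real.norm_eq_abs, Real.norm_eq_abs]
    refine mul_le_mul hs' ?_ (by positivity) (abs_nonneg t)
    have hn : (1 : ℝ) ≤ n + 1 := by linarith [Nat.cast_nonneg (α := ℝ) n]
    have h1 : |-2 * r ^ (n + 1) / ((n : ℝ) + 1)| ≤ 2 * r ^ n := by
      rw [abs_div, abs_mul, abs_of_nonneg (pow_nonneg hr0 _),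
        abs_of_pos (by linarith : (0 : ℝ) < n + 1)]
      norm_num
      calc 2 * r ^ (n + 1) / ((n : ℝ) + 1) ≤ 2 * r ^ (n + 1) := div_le_self (by positivity) hn
        _ ≤ 2 * r ^ n := by
          have := pow_le_pow_of_le_one hr0 hr1.le (Nat.le_succ n)
          simpa using this
    calc _ ≤ |-2 * r ^ (n + 1) / ((n : ℝ) + 1)| * 1 :=
          mul_le_mul_of_nonneg_left (Real.abs_cos_le_one _) (abs_nonneg _)
      _ ≤ _ := by rwa [mul_one]

/-- If `sin α = v x` and `sin β = w x`, then `φ = β - α` satisfies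
`sin² φ = w² x² (1 + r² - 2 r cos φ)` with `r = v / w`, which makes `dx / x` explicit in `φ`. -/
theorem integral_arcsin_sub_sq_div {v w : ℝ} (hv : 0 ≤ v) (hvw : v < w) (hw : w ≤ 1) {θ : ℝ}
    (hθ : θ = Real.arcsin w - Real.arcsin v) :
    ∫ x in (0 : ℝ)..1, (Real.arcsin (w * x) - Real.arcsin (v * x)) ^ 2 / x =
      S (Real.sin θ) (Real.sin θ)
        - θ ^ 2 / 2 * Real.log (1 + (v / w) ^ 2 - 2 * (v / w) * Real.cos θ)
        + ∫ s in (0 : ℝ)..θ, s * Real.log (1 + (v / w) ^ 2 - 2 * (v / w) * Real.cos s) := by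
  have hw0 : 0 < w := hv.trans_lt hvw
  set r := v / w with hr
  have hr0 : 0 ≤ r := by positivity
  have hr1 : r < 1 := (div_lt_one hw0).2 hvw
  have hD := one_add_sq_sub_two_mul_cos_pos hr0 hr1
  have hDc : Continuous fun s : ℝ => Real.log (1 + r ^ 2 - 2 * r * Real.cos s) :=
    Continuous.log (by fun_prop) fun s => (hD s).ne'
  have hLd : ∀ t, HasDerivAt
      (fun t => ∫ s in (0 : ℝ)..t, s * Real.log (1 + r ^ 2 - 2 * r * Real.cos s))
      (t * Real.log (1 + r ^ 2 - 2 * r * Real.cos t)) t := fun t =>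
    ((continuous_id.mul hDc).integral_hasStrictDerivAt 0 t).hasDerivAt
  have hLc : Continuous fun t => ∫ s in (0 : ℝ)..t, s * Real.log (1 + r ^ 2 - 2 * r * Real.cos s) :=
    continuous_iff_continuousAt.2 fun t => (hLd t).continuousAt
  set φ : ℝ → ℝ := fun x => Real.arcsin (w * x) - Real.arcsin (v * x) with hφ
  have hφc : Continuous φ := by fun_prop
  set G : ℝ → ℝ := fun t => S (Real.sin t) (Real.sin t)
    - t ^ 2 / 2 * Real.log (1 + r ^ 2 - 2 * r * Real.cos t)
    + ∫ s in (0 : ℝ)..t, s * Real.log (1 + r ^ 2 - 2 * r * Real.cos s) with hG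
  have hGc : Continuous G :=
    ((continuous_S_self.comp Real.continuous_sin).sub
      (((continuous_pow 2).div_const 2).mul hDc)).add hLc
  have hφ1 : φ 1 = θ := by simp [hφ, hθ]
  have hG0 : G (φ 0) = 0 := by simp [hG, hφ, S]
  have main : ∫ x in (0 : ℝ)..1, φ x ^ 2 / x = G (φ 1) - G (φ 0) := by
    refine intervalIntegral.integral_eq_sub_of_hasDerivAt_of_le zero_le_one
      (f := fun x => G (φ x)) (hGc.comp hφc).continuousOn (fun x hx => ?_)
      (intervalIntegrable_arcsin_sub_sq_div v w 0 1)
    obtain ⟨hx0, hx1⟩ := hx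
    have hb0 : 0 < w * x := by positivity
    have hb1 : w * x < 1 := by nlinarith
    have ha0 : 0 ≤ v * x := by positivity
    have hab : v * x < w * x := by nlinarith
    have hsa : Real.sin (Real.arcsin (v * x)) = v * x :=
      Real.sin_arcsin (by linarith) (by linarith)
    have hsb : Real.sin (Real.arcsin (w * x)) = w * x :=
      Real.sin_arcsin (by linarith) (by linarith)
    set p := √(1 - (v * x) ^ 2) with hp
    set q := √(1 - (w * x) ^ 2) with hq
    have hp0 : 0 < p := Real.sqrt_pos.2 (by nlinarith)
    have hq0 : 0 < q := Real.sqrt_pos.2 (by nlinarith)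
    have hp2 : p ^ 2 = 1 - (v * x) ^ 2 := Real.sq_sqrt (by nlinarith)
    have hq2 : q ^ 2 = 1 - (w * x) ^ 2 := Real.sq_sqrt (by nlinarith)
    have hsin : Real.sin (φ x) = w * x * p - q * (v * x) := by
      simp only [hφ, Real.sin_sub, hsa, hsb, Real.cos_arcsin, ← hp, ← hq]
    have hcos : Real.cos (φ x) = q * p + w * x * (v * x) := by
      simp only [hφ, Real.cos_sub, hsa, hsb, Real.cos_arcsin, ← hp, ← hq]
    have hφpos : 0 < φ x :=
      sub_pos.2 (Real.strictMonoOn_arcsin ⟨by linarith, by linarith⟩ ⟨by linarith, by linarith⟩ hab)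
    have hφlt : φ x < π / 2 := by
      have h1 : Real.arcsin (w * x) < π / 2 := Real.arcsin_lt_pi_div_two.2 hb1
      have h2 : 0 ≤ Real.arcsin (v * x) := Real.arcsin_nonneg.2 ha0
      simp only [hφ]
      linarith
    have hspos : 0 < Real.sin (φ x) := Real.sin_pos_of_pos_of_lt_pi hφpos (by linarith)
    have hsD : Real.sin (φ x) ^ 2 = (w * x) ^ 2 * (1 + r ^ 2 - 2 * r * Real.cos (φ x)) := by
      have : (w * x) ^ 2 * (1 + r ^ 2 - 2 * r * Real.cos (φ x)) =
          (w * x) ^ 2 + (v * x) ^ 2 - 2 * (w * x) * (v * x) * Real.cos (φ x) := by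
        rw [hr]; field_simp
      rw [this, hcos, hsin]
      linear_combination (w * x) ^ 2 * hp2 + (v * x) ^ 2 * hq2
    have hφd : HasDerivAt φ (w / q - v / p) x := by
      have e1 : HasDerivAt (fun x : ℝ => w * x) w x := by
        simpa using (hasDerivAt_id x).const_mul w
      have e2 : HasDerivAt (fun x : ℝ => v * x) v x := by
        simpa using (hasDerivAt_id x).const_mul v
      have e3 := (Real.hasDerivAt_arcsin (x := w * x) (by linarith) (by linarith)).comp x e1
      have e4 := (Real.hasDerivAt_arcsin (x := v * x) (by linarith) (by linarith)).comp x e2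
      refine (e3.sub e4).congr_deriv ?_
      rw [← hp, ← hq]
      ring
    have hasin : Real.arcsin (Real.sin (φ x)) = φ x :=
      Real.arcsin_sin (by linarith) hφlt.le
    have hdiv : arcsinDiv (Real.sin (φ x)) = φ x / Real.sin (φ x) := by
      rw [eq_div_iff hspos.ne', arcsinDiv_mul, hasin]
    have hlogd : HasDerivAt (fun t => Real.log (1 + r ^ 2 - 2 * r * Real.cos t))
        (2 * r * Real.sin (φ x) / (1 + r ^ 2 - 2 * r * Real.cos (φ x))) (φ x) := by
      refine HasDerivAt.log ?_ (hD _).ne'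
      refine (((Real.hasDerivAt_cos (φ x)).const_mul (2 * r)).const_sub (1 + r ^ 2)).congr_deriv ?_
      ring
    have hGd := (((hasDerivAt_S_self (Real.sin (φ x))).comp (φ x)
      (Real.hasDerivAt_sin (φ x))).sub
      (((hasDerivAt_pow 2 (φ x)).div_const 2).mul hlogd)).add (hLd (φ x))
    refine (HasDerivAt.comp x hGd hφd).congr_deriv ?_
    have hfrac : r * Real.sin (φ x) / (1 + r ^ 2 - 2 * r * Real.cos (φ x)) =
        v * w * x ^ 2 / Real.sin (φ x) := by
      rw [div_eq_div_iff (hD _).ne' hspos.ne', mul_assoc, ← sq, hsD, hr]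
      field_simp
    have hbr : (w / q - v / p) * (Real.cos (φ x) / Real.sin (φ x) -
        r * Real.sin (φ x) / (1 + r ^ 2 - 2 * r * Real.cos (φ x))) = 1 / x := by
      have hne : w * p - q * v ≠ 0 := by
        rintro h
        exact hspos.ne' (by linear_combination hsin + x * h)
      rw [hfrac, ← sub_div, hcos, hsin, show w * x * p - q * (v * x) = x * (w * p - q * v) by ring]
      field_simp
      ring
    rw [hdiv, hasin, div_eq_mul_one_div (φ x ^ 2) x, ← hbr]
    push_cast
    ring
  rw [main, hG0, hφ1, sub_zero]

theorem norm_ofReal_mul_cexp {r : ℝ} (hr0 : 0 ≤ r) (t : ℝ) :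
    ‖(r : ℂ) * Complex.exp (Complex.I * (t : ℂ))‖ = r := by
  rw [norm_mul, mul_comm Complex.I, Complex.norm_exp_ofReal_mul_I, Complex.norm_real,
    Real.norm_eq_abs, abs_of_nonneg hr0, mul_one]

theorem summable_pow_div_pow {z : ℂ} (hz : ‖z‖ < 1) (k : ℕ) :
    Summable fun n : ℕ => z ^ (n + 1) / ((n + 1 : ℕ) : ℂ) ^ k := by
  refine Summable.of_norm_bounded
    ((summable_nat_add_iff 1).2 (summable_geometric_of_lt_one (norm_nonneg z) hz)) fun n => ?_
  rw [norm_div, norm_pow, norm_pow, Complex.norm_natCast]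
  exact div_le_self (by positivity) (one_le_pow₀ (by exact_mod_cast Nat.le_add_left 1 n))

theorem integral_mul_log_eq_polylog {r : ℝ} (hr0 : 0 ≤ r) (hr1 : r < 1) (t : ℝ) :
    ((∫ s in (0 : ℝ)..t, s * Real.log (1 + r ^ 2 - 2 * r * Real.cos s) : ℝ) : ℂ) =
      2 * Li3c (r : ℂ)
        - Li3c ((r : ℂ) * Complex.exp (Complex.I * (t : ℂ)))
        - Li3c ((r : ℂ) * Complex.exp (-(Complex.I * (t : ℂ))))
        + Complex.I * (t : ℂ) * Li2c ((r : ℂ) * Complex.exp (Complex.I * (t : ℂ)))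
        - Complex.I * (t : ℂ) * Li2c ((r : ℂ) * Complex.exp (-(Complex.I * (t : ℂ)))) := by
  have h0 : ‖(r : ℂ)‖ < 1 := by
    rwa [Complex.norm_real, Real.norm_eq_abs, abs_of_nonneg hr0]
  have h1 : ‖(r : ℂ) * Complex.exp (Complex.I * (t : ℂ))‖ < 1 := by
    rwa [norm_ofReal_mul_cexp hr0]
  have h2 : ‖(r : ℂ) * Complex.exp (-(Complex.I * (t : ℂ)))‖ < 1 := by
    have := norm_ofReal_mul_cexp hr0 (-t)
    rw [Complex.ofReal_neg, mul_neg] at this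
    rwa [this]
  have hs := Complex.hasSum_ofReal.2 (hasSum_integral_mul_log hr0 hr1 t)
  have hp := (((((summable_pow_div_pow h0 3).hasSum.mul_left 2).sub
    (summable_pow_div_pow h1 3).hasSum).sub (summable_pow_div_pow h2 3).hasSum).add
    ((summable_pow_div_pow h1 2).hasSum.mul_left (Complex.I * t))).sub
    ((summable_pow_div_pow h2 2).hasSum.mul_left (Complex.I * t))
  refine hs.unique ((congrArg (HasSum · _) (funext fun n => ?_)).mpr hp)
  have hn : ((n : ℂ) + 1) ≠ 0 := by exact_mod_cast Nat.succ_ne_zero n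
  simp only [mul_pow, ← Complex.exp_nat_mul]
  push_cast
  simp only [Complex.cos, Complex.sin]
  rw [show ((n : ℂ) + 1) * t * Complex.I = (n + 1) * (Complex.I * t) by ring,
    show -(((n : ℂ) + 1) * t) * Complex.I = (n + 1) * -(Complex.I * t) by ring]
  field_simp
  ring

theorem S_v_w_closed_form (v w : ℝ) (hv : 0 ≤ v) (hvw : v < w) (hw : w ≤ 1)
    (θ : ℝ) (hθ : θ = Real.arcsin w - Real.arcsin v) :
    2 * (S v w : ℂ) =
      (S v v : ℝ) + (S w w : ℝ) - (S (Real.sin θ) (Real.sin θ) : ℝ)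
        - 2 * Li3c ((v / w : ℝ) : ℂ)
        + Li3c (((v / w : ℝ) : ℂ) * Complex.exp (Complex.I * (θ : ℂ)))
        + Li3c (((v / w : ℝ) : ℂ) * Complex.exp (-(Complex.I * (θ : ℂ))))
        - Complex.I * (θ : ℂ) *
            Li2c (((v / w : ℝ) : ℂ) * Complex.exp (Complex.I * (θ : ℂ)))
        + Complex.I * (θ : ℂ) *
            Li2c (((v / w : ℝ) : ℂ) * Complex.exp (-(Complex.I * (θ : ℂ))))
        + (((θ ^ 2 / 2) : ℝ) : ℂ) *
            ((Real.log (1 + v ^ 2 / w ^ 2 - 2 * (v / w) * Real.cos θ) : ℝ) : ℂ) := by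
  have hw0 : 0 < w := hv.trans_lt hvw
  have hr0 : 0 ≤ v / w := by positivity
  have hr1 : v / w < 1 := (div_lt_one hw0).2 hvw
  have h := congrArg (fun y : ℝ => (y : ℂ)) (two_mul_S v w)
  simp only [integral_arcsin_sub_sq_div hv hvw hw hθ] at h
  have hL := integral_mul_log_eq_polylog hr0 hr1 θ
  simp only [Complex.ofReal_mul, Complex.ofReal_sub, Complex.ofReal_add, Complex.ofReal_ofNat,
    hL] at h
  rw [← div_pow]
  linear_combination h
end

section
/- Let k be a real number with 0 < k < 1, let K = ∫₀¹ dz/√((1−z²)(1−k²z²)), K' = ∫₀¹ dz/√((1−z²)(1−(1−k²)z²)), and q = exp(−πK'/K) (so 0 < q < 1). Then (Li₂(k) − Li₂(−k))/8 = ∑_{n=0}^∞ q^{n+1/2} / ( (2n+1)²·(1 + q^{2n+1}) ) + 4·∑_{n=0}^∞ ∑_{m=1}^∞ q^{n+m+1/2} / ( ((2n+1)² − (2m)²)·(1 + q^{2m})·(1 + q^{2n+1}) ). -/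
open Real MeasureTheory intervalIntegral

/-- The dilogarithm `Li₂(z) = ∑_{n≥1} zⁿ/n²` (real). -/
noncomputable def Li2 (z : ℝ) : ℝ := ∑' n : ℕ, z ^ (n + 1) / ((n + 1 : ℕ) : ℝ) ^ 2

/-! ### Trigonometric series with exponentially decaying coefficients -/

/-- A family indexed by `ℤ` is exponentially decaying. -/
def ExpDecay (f : ℤ → ℝ) : Prop :=
  ∃ B r : ℝ, 0 < r ∧ r < 1 ∧ ∀ n, |f n| ≤ B * r ^ n.natAbs

/-- The series `∑ₙ f(n) e^{i(2n+p)x}`. -/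
noncomputable def trigSeries (p : ℤ) (f : ℤ → ℝ) (x : ℝ) : ℂ :=
  ∑' n : ℤ, (f n : ℂ) * Complex.exp (((2 * n + p : ℤ) : ℂ) * x * Complex.I)

lemma summable_int_pow_mul_geometric {r : ℝ} (h0 : 0 < r) (h1 : r < 1) (j : ℕ) :
    Summable fun n : ℤ => (n.natAbs : ℝ) ^ j * r ^ n.natAbs := by
  have h : Summable fun n : ℕ => (n : ℝ) ^ j * r ^ n :=
    summable_pow_mul_geometric_of_norm_lt_one j (by rwa [Real.norm_of_nonneg h0.le])
  refine Summable.of_nat_of_neg ?_ ?_ <;> simpa using h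

lemma ExpDecay.summable_abs {f : ℤ → ℝ} (hf : ExpDecay f) : Summable fun n => |f n| := by
  obtain ⟨B, r, h0, h1, h⟩ := hf
  refine Summable.of_nonneg_of_le (fun _ => abs_nonneg _) h (Summable.mul_left B ?_)
  simpa using summable_int_pow_mul_geometric h0 h1 0

lemma ExpDecay.summable {f : ℤ → ℝ} (hf : ExpDecay f) : Summable f :=
  hf.summable_abs.of_abs

lemma ExpDecay.summable_abs_freq_mul {f : ℤ → ℝ} (hf : ExpDecay f) (p : ℤ) :
    Summable fun n : ℤ => |((2 * n + p : ℤ) : ℝ) * f n| := by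
  obtain ⟨B, r, h0, h1, h⟩ := hf
  have hs := ((summable_int_pow_mul_geometric h0 h1 1).mul_left (2 * B)).add
    ((summable_int_pow_mul_geometric h0 h1 0).mul_left (|(p : ℝ)| * B))
  refine Summable.of_nonneg_of_le (fun _ => abs_nonneg _) (fun n => ?_) hs
  have hn : |((2 * n + p : ℤ) : ℝ)| ≤ 2 * (n.natAbs : ℝ) + |(p : ℝ)| := by
    push_cast
    refine (abs_add_le _ _).trans ?_
    rw [abs_mul, Nat.cast_natAbs]; simp
  rw [abs_mul]
  calc _ ≤ (2 * (n.natAbs : ℝ) + |(p : ℝ)|) * (B * r ^ n.natAbs) :=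
        mul_le_mul hn (h n) (abs_nonneg _) (by positivity)
    _ = _ := by ring

lemma norm_trigTerm (c : ℝ) (m : ℤ) (x : ℝ) :
    ‖(c : ℂ) * Complex.exp ((m : ℂ) * x * Complex.I)‖ = |c| := by
  have : (m : ℂ) * x = ((m * x : ℝ) : ℂ) := by push_cast; rfl
  rw [norm_mul, this, Complex.norm_exp_ofReal_mul_I, mul_one, Complex.norm_real, Real.norm_eq_abs]

lemma summable_norm_trigTerm {f : ℤ → ℝ} (hf : Summable fun n => |f n|) (p : ℤ) (x : ℝ) :
    Summable fun n : ℤ => ‖(f n : ℂ) * Complex.exp (((2 * n + p : ℤ) : ℂ) * x * Complex.I)‖ := by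
  simpa only [norm_trigTerm] using hf

lemma trigSeries_mul {f g : ℤ → ℝ} (hf : ExpDecay f) (hg : ExpDecay g) (p r : ℤ) (x : ℝ) :
    trigSeries p f x * trigSeries r g x =
      trigSeries (p + r) (fun N => ∑' m, f m * g (N - m)) x := by
  have h1 := summable_norm_trigTerm hf.summable_abs p x
  have h2 := summable_norm_trigTerm hg.summable_abs r x
  unfold trigSeries
  rw [tsum_mul_tsum_of_summable_norm h1 h2]
  have hs := summable_mul_of_summable_norm h1 h2
  let e : ℤ × ℤ ≃ ℤ × ℤ :=
    { toFun := fun z => (z.2, z.1 - z.2)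
      invFun := fun z => (z.1 + z.2, z.1)
      left_inv := fun z => by simp
      right_inv := fun z => by simp }
  rw [← e.tsum_eq]
  have hs' := (e.summable_iff).mpr hs
  refine (Summable.tsum_prod hs').trans (tsum_congr fun N => ?_)
  rw [Complex.ofReal_tsum, ← tsum_mul_right]
  refine tsum_congr fun m => ?_
  simp only [e, Equiv.coe_fn_mk, Function.comp_apply]
  rw [mul_mul_mul_comm, ← Complex.exp_add]
  push_cast
  congr 2
  ring

lemma trigSeries_shift (f : ℤ → ℝ) (p : ℤ) (x : ℝ) :
    trigSeries (p + 2) (fun n => f (n + 1)) x = trigSeries p f x := by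
  unfold trigSeries
  rw [← (Equiv.addRight (1 : ℤ)).tsum_eq (fun n : ℤ =>
    (f n : ℂ) * Complex.exp (((2 * n + p : ℤ) : ℂ) * x * Complex.I))]
  refine tsum_congr fun n => ?_
  simp only [Equiv.coe_addRight]
  congr 4
  ring_nf

lemma hasDerivAt_trigSeries {f : ℤ → ℝ} (hf : ExpDecay f) (p : ℤ) (x : ℝ) :
    HasDerivAt (trigSeries p f)
      (Complex.I * trigSeries p (fun n => ((2 * n + p : ℤ) : ℝ) * f n) x) x := by
  unfold trigSeries
  rw [← tsum_mul_left]
  refine hasDerivAt_tsum (𝕜 := ℝ)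
    (g := fun (n : ℤ) (y : ℝ) =>
      (f n : ℂ) * Complex.exp (((2 * n + p : ℤ) : ℂ) * y * Complex.I))
    (g' := fun (n : ℤ) (y : ℝ) => Complex.I * (((((2 * n + p : ℤ) : ℝ) * f n : ℝ) : ℂ) *
      Complex.exp (((2 * n + p : ℤ) : ℂ) * y * Complex.I)))
    (hf.summable_abs_freq_mul p) (fun n y => ?_) (fun n y => ?_)
    (y₀ := x) (summable_norm_trigTerm hf.summable_abs p x).of_norm x
  · have h0 : HasDerivAt (fun y : ℝ => (y : ℂ)) 1 y := Complex.ofRealCLM.hasDerivAt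
    have h := ((h0.const_mul ((2 * n + p : ℤ) : ℂ)).mul_const Complex.I).cexp.const_mul (f n : ℂ)
    refine h.congr_deriv ?_
    push_cast
    ring
  · rw [norm_mul, Complex.norm_I, one_mul, norm_trigTerm]

/-- If `f(-p-n) = ε f(n)` then conjugating the trigonometric series multiplies it by `ε`. -/
lemma conj_trigSeries {f : ℤ → ℝ} {p : ℤ} {ε : ℝ} (h : ∀ n, f (-p - n) = ε * f n) (x : ℝ) :
    (starRingEnd ℂ) (trigSeries p f x) = ε * trigSeries p f x := by
  unfold trigSeries
  rw [Complex.conj_tsum, ← tsum_mul_left, ← (Equiv.subLeft (-p)).tsum_eq]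
  refine tsum_congr fun n => ?_
  simp only [Equiv.subLeft_apply, h]
  rw [map_mul, Complex.conj_ofReal, ← Complex.exp_conj]
  push_cast
  simp only [map_mul, map_add, map_sub, map_neg, Complex.conj_ofReal, Complex.conj_I]
  rw [mul_assoc]
  congr 3
  simp [map_ofNat]
  ring

lemma trigSeries_of_symm {f : ℤ → ℝ} {p : ℤ} (h : ∀ n, f (-p - n) = f n) (x : ℝ) :
    trigSeries p f x = ((trigSeries p f x).re : ℂ) := by
  have := conj_trigSeries (ε := 1) (by simpa using h) x
  rw [Complex.ofReal_one, one_mul] at this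
  exact (Complex.conj_eq_iff_re.mp this).symm

lemma trigSeries_of_antisymm {f : ℤ → ℝ} {p : ℤ} (h : ∀ n, f (-p - n) = -f n) (x : ℝ) :
    trigSeries p f x = Complex.I * ((trigSeries p f x).im : ℂ) := by
  have := conj_trigSeries (ε := -1) (by simpa using h) x
  have h2 := congrArg Complex.re this
  simp at h2
  apply Complex.ext <;> simp
  linarith

lemma trigSeries_re {f : ℤ → ℝ} (hf : Summable fun n => |f n|) (p : ℤ) (x : ℝ) :
    (trigSeries p f x).re = ∑' n : ℤ, f n * cos (((2 * n + p : ℤ) : ℝ) * x) := by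
  unfold trigSeries
  rw [Complex.re_tsum (summable_norm_trigTerm hf p x).of_norm]
  refine tsum_congr fun n => ?_
  rw [Complex.re_ofReal_mul]
  congr 1
  rw [← Complex.exp_ofReal_mul_I_re]; push_cast; rfl

lemma trigSeries_im {f : ℤ → ℝ} (hf : Summable fun n => |f n|) (p : ℤ) (x : ℝ) :
    (trigSeries p f x).im = ∑' n : ℤ, f n * sin (((2 * n + p : ℤ) : ℝ) * x) := by
  unfold trigSeries
  rw [Complex.im_tsum (summable_norm_trigTerm hf p x).of_norm]
  refine tsum_congr fun n => ?_
  rw [Complex.im_ofReal_mul]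
  congr 1
  rw [← Complex.exp_ofReal_mul_I_im]; push_cast; rfl

/-! ### Hyperbolic coefficients and their convolutions -/

/-- The coefficients `1 / cosh(a(n+c))`. -/
noncomputable def sechCoeff (a c : ℝ) (n : ℤ) : ℝ := 1 / cosh (a * (n + c))

/-- The coefficients `1 / sinh(a(n+1/2))`. -/
noncomputable def cschCoeff (a : ℝ) (n : ℤ) : ℝ := 1 / sinh (a * (n + 1 / 2))

lemma sechCoeff_pos (a c : ℝ) (n : ℤ) : 0 < sechCoeff a c n :=
  one_div_pos.mpr (cosh_pos _)

lemma one_div_cosh_le (y : ℝ) : 1 / cosh y ≤ 2 * exp (-|y|) := by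
  rw [div_le_iff₀ (cosh_pos _), ← cosh_abs, cosh_eq]
  have h : exp (-|y|) * exp |y| = 1 := by rw [← exp_add]; simp
  nlinarith [exp_pos (-|y|), exp_pos |y|, mul_pos (exp_pos (-|y|)) (exp_pos (-|y|))]

lemma expDecay_sechCoeff {a : ℝ} (ha : 0 < a) (c : ℝ) : ExpDecay (sechCoeff a c) := by
  refine ⟨2 * exp (a * |c|), exp (-a), exp_pos _, by simpa using ha, fun n => ?_⟩
  rw [abs_of_pos (sechCoeff_pos a c n)]
  refine (one_div_cosh_le _).trans ?_
  rw [← exp_nat_mul, mul_assoc, ← exp_add, Nat.cast_natAbs, Int.cast_abs, abs_mul, abs_of_pos ha]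
  gcongr
  have : |(n : ℝ)| ≤ |n + c| + |c| := by
    simpa using abs_add_le ((n : ℝ) + c) (-c)
  nlinarith

lemma half_odd_abs_ge (n : ℤ) : (1 / 2 : ℝ) ≤ |(n : ℝ) + 1 / 2| := by
  rcases le_or_gt 0 n with h | h
  · have : (0 : ℝ) ≤ n := by exact_mod_cast h
    rw [abs_of_nonneg (by linarith)]; linarith
  · have : (n : ℝ) ≤ -1 := by exact_mod_cast Int.le_sub_one_of_lt h
    rw [abs_of_nonpos (by linarith)]; linarith

lemma sinh_half_odd_ne_zero {a : ℝ} (ha : 0 < a) (n : ℤ) : sinh (a * (n + 1 / 2)) ≠ 0 := by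
  rw [Ne, sinh_eq_zero, mul_eq_zero, not_or]
  refine ⟨ha.ne', fun h => ?_⟩
  have := half_odd_abs_ge n
  rw [h, abs_zero] at this
  linarith

lemma abs_cschCoeff_le {a : ℝ} (ha : 0 < a) (n : ℤ) :
    |cschCoeff a n| ≤ cosh (a / 2) / sinh (a / 2) * sechCoeff a (1 / 2) n := by
  unfold cschCoeff sechCoeff
  have h1 : 0 < sinh (a / 2) := sinh_pos_iff.mpr (by linarith)
  set y := a * ((n : ℝ) + 1 / 2) with hy
  have hy2 : a / 2 ≤ |y| := by
    rw [hy, abs_mul, abs_of_pos ha]; nlinarith [half_odd_abs_ge n]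
  have h2 : 0 ≤ sinh (|y| - a / 2) := sinh_nonneg_iff.mpr (by linarith)
  rw [sinh_sub, cosh_abs] at h2
  rw [abs_div, abs_one, abs_sinh, div_mul_div_comm, mul_one,
    div_le_div_iff₀ (sinh_pos_iff.mpr (by linarith)) (by positivity)]
  linarith

lemma expDecay_cschCoeff {a : ℝ} (ha : 0 < a) : ExpDecay (cschCoeff a) := by
  obtain ⟨B, r, h0, h1, h⟩ := expDecay_sechCoeff ha (1 / 2)
  refine ⟨cosh (a / 2) / sinh (a / 2) * B, r, h0, h1, fun n => ?_⟩
  have hp : 0 < cosh (a / 2) / sinh (a / 2) :=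
    div_pos (cosh_pos _) (sinh_pos_iff.mpr (by linarith))
  refine (abs_cschCoeff_le ha n).trans ?_
  rw [mul_assoc]
  exact mul_le_mul_of_nonneg_left ((le_abs_self _).trans (h n)) hp.le

lemma tendsto_tanh_atTop : Filter.Tendsto tanh Filter.atTop (nhds 1) := by
  have h : ∀ x : ℝ, tanh x = 1 - 2 / (exp (2 * x) + 1) := fun x => by
    rw [tanh_eq, exp_neg, two_mul, exp_add]
    have := exp_pos x
    field_simp
    ring
  have h2 : Filter.Tendsto (fun x : ℝ => exp (2 * x) + 1) Filter.atTop Filter.atTop :=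
    Filter.tendsto_atTop_add_const_right _ _
      (tendsto_exp_atTop.comp (Filter.tendsto_id.const_mul_atTop two_pos))
  simpa [funext h] using (h2.const_div_atTop 2).const_sub 1

lemma tanh_sub_tanh (u v : ℝ) : tanh u - tanh v = sinh (u - v) / (cosh u * cosh v) := by
  rw [tanh_eq_sinh_div_cosh, tanh_eq_sinh_div_cosh, sinh_sub]
  have := cosh_pos u
  have := cosh_pos v
  field_simp

lemma hasSum_tanh_succ_sub {a : ℝ} (ha : 0 < a) (c : ℝ) :
    HasSum (fun m : ℤ => tanh (a * (m + (c + 1))) - tanh (a * (m + c))) 2 := by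
  have hs : Summable fun m : ℤ => tanh (a * (m + (c + 1))) - tanh (a * (m + c)) := by
    refine Summable.of_norm_bounded ((expDecay_sechCoeff ha c).summable.mul_left (sinh a))
      fun m => ?_
    rw [tanh_sub_tanh, Real.norm_eq_abs, sechCoeff]
    have h1 : 0 < sinh a := sinh_pos_iff.mpr ha
    rw [show a * ((m : ℝ) + (c + 1)) - a * (m + c) = a by ring, abs_of_pos (by positivity),
      mul_one_div]
    gcongr
    exact le_mul_of_one_le_left (cosh_pos _).le (one_le_cosh _)
  have lim : ∀ b : ℝ, Filter.Tendsto (fun n : ℕ => tanh (a * (n + b))) Filter.atTop (nhds 1) :=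
    fun b => tendsto_tanh_atTop.comp (Filter.Tendsto.const_mul_atTop ha
      (Filter.tendsto_atTop_add_const_right _ _ tendsto_natCast_atTop_atTop))
  have e : (2 : ℝ) = (1 - tanh (a * c)) + (1 - tanh (a * (-c))) := by
    rw [mul_neg, tanh_neg]; ring
  rw [e]
  refine HasSum.of_nat_of_neg_add_one ?_ ?_
  · have h : Summable fun n : ℕ =>
        tanh (a * (((n : ℤ) : ℝ) + (c + 1))) - tanh (a * (((n : ℤ) : ℝ) + c)) :=
      hs.comp_injective Nat.cast_injective
    refine h.hasSum_iff_tendsto_nat.mpr ?_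
    have := (lim c).sub_const (tanh (a * c))
    refine this.congr fun n => ?_
    have h3 := Finset.sum_range_sub (fun n : ℕ => tanh (a * (n + c))) n
    simp only [Nat.cast_zero, zero_add] at h3
    rw [← h3]
    refine Finset.sum_congr rfl fun i _ => ?_
    push_cast
    ring_nf
  · have h : Summable fun n : ℕ => tanh (a * (((-((n : ℤ) + 1) : ℤ) : ℝ) + (c + 1))) -
        tanh (a * (((-((n : ℤ) + 1) : ℤ) : ℝ) + c)) :=
      hs.comp_injective (i := fun n : ℕ => -((n : ℤ) + 1)) (fun x y hxy => by simpa using hxy)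
    refine h.hasSum_iff_tendsto_nat.mpr ?_
    have := (lim (-c)).sub_const (tanh (a * (-c)))
    refine this.congr fun n => ?_
    have h3 := Finset.sum_range_sub (fun n : ℕ => tanh (a * (n + -c))) n
    simp only [Nat.cast_zero, zero_add] at h3
    rw [← h3]
    refine Finset.sum_congr rfl fun i _ => ?_
    rw [show a * (((i + 1 : ℕ) : ℝ) + -c) = -(a * (((-((i : ℤ) + 1) : ℤ) : ℝ) + c)) by
        push_cast; ring,
      show a * ((i : ℝ) + -c) = -(a * (((-((i : ℤ) + 1) : ℤ) : ℝ) + (c + 1))) by push_cast; ring,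
      tanh_neg, tanh_neg]
    ring

lemma hasSum_tanh_nat_shift_sub {a : ℝ} (ha : 0 < a) (c : ℝ) (j : ℕ) :
    HasSum (fun m : ℤ => tanh (a * (m + (c + j))) - tanh (a * (m + c))) (2 * j) := by
  induction j with
  | zero => simp
  | succ j ih =>
    convert! (hasSum_tanh_succ_sub ha (c + j)).add ih using 1
    · ext m; push_cast; ring_nf
    · push_cast; ring

lemma hasSum_tanh_shift_sub {a : ℝ} (ha : 0 < a) (c : ℝ) (j : ℤ) :
    HasSum (fun m : ℤ => tanh (a * (m + (c + j))) - tanh (a * (m + c))) (2 * j) := by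
  obtain ⟨n, rfl | rfl⟩ := j.eq_nat_or_neg
  · simpa using hasSum_tanh_nat_shift_sub ha c n
  · convert! (hasSum_tanh_nat_shift_sub ha (c - n) n).neg using 1
    · ext m; push_cast; ring_nf
    · push_cast; ring

/-- The sum of `F(m) - tanh(a(m+c))` when `F` is antisymmetric about `p/2` and `2c ∈ ℤ`. -/
lemma tsum_sub_tanh_of_antisymm {a : ℝ} (ha : 0 < a) {c : ℝ} {p j : ℤ} (hj : (j : ℝ) = -p - 2 * c)
    {F : ℤ → ℝ} (hF : ∀ m, F (p - m) = -F m)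
    (hs : Summable fun m : ℤ => F m - tanh (a * (m + c))) :
    ∑' m : ℤ, (F m - tanh (a * (m + c))) = j := by
  have h1 := hs.hasSum
  have h2 := (Equiv.subLeft p).hasSum_iff.mpr h1
  have h3 := (h1.add h2).unique (a₂ := 2 * (j : ℝ)) (by
    convert! hasSum_tanh_shift_sub ha c j using 1
    ext m
    simp only [Function.comp_apply, Equiv.subLeft_apply, hF]
    rw [show a * ((m : ℝ) + (c + j)) = -(a * (((p - m : ℤ) : ℝ) + c)) by push_cast; rw [hj]; ring,
      tanh_neg]
    ring)
  linarith

lemma ExpDecay.summable_conv {f g : ℤ → ℝ} (hf : ExpDecay f) (hg : ExpDecay g) (N : ℤ) :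
    Summable fun m => f m * g (N - m) := by
  have hb : ∀ n, |g n| ≤ ∑' m, |g m| := fun n =>
    hg.summable_abs.le_tsum n (fun _ _ => abs_nonneg _)
  refine Summable.of_norm_bounded (hf.summable_abs.mul_right (∑' m, |g m|)) fun m => ?_
  rw [norm_mul]
  exact mul_le_mul_of_nonneg_left (hb _) (abs_nonneg _)

lemma tsum_sech_mul_sech {a : ℝ} (ha : 0 < a) (N : ℤ) :
    ∑' m, sechCoeff a (1 / 2) m * sechCoeff a 0 (N - m) =
      ((2 * N + 1 : ℤ) : ℝ) * cschCoeff a N := by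
  have hne := sinh_half_odd_ne_zero ha N
  have key : ∀ m : ℤ, tanh (a * (m + 1 / 2)) - tanh (a * (m + (-N : ℝ))) =
      sinh (a * (N + 1 / 2)) * (sechCoeff a (1 / 2) m * sechCoeff a 0 (N - m)) := fun m => by
    rw [tanh_sub_tanh, sechCoeff, sechCoeff,
      show a * ((m : ℝ) + 1 / 2) - a * (m + (-N : ℝ)) = a * (N + 1 / 2) by ring,
      show a * (((N - m : ℤ) : ℝ) + 0) = -(a * (m + (-N : ℝ))) by push_cast; ring, cosh_neg,
      div_mul_div_comm]
    ring
  have hs := ((expDecay_sechCoeff ha (1 / 2)).summable_conv (expDecay_sechCoeff ha 0) N).mul_left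
    (sinh (a * (N + 1 / 2)))
  rw [← funext key] at hs
  have h := tsum_sub_tanh_of_antisymm ha (p := -1) (j := 2 * N + 1) (by push_cast; ring)
    (F := fun m : ℤ => tanh (a * (m + 1 / 2)))
    (fun m => by rw [← tanh_neg]; congr 1; push_cast; ring) hs
  rw [tsum_congr key, tsum_mul_left] at h
  rw [← h, cschCoeff, mul_one_div, mul_div_cancel_left₀ _ hne]

lemma tsum_csch_mul_sech {a : ℝ} (ha : 0 < a) {e : ℝ} {j : ℤ} (N : ℤ)
    (hj : (j : ℝ) = 2 * (N + e) + 1) :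
    ∑' m, cschCoeff a m * sechCoeff a e (N - m) = j * (1 / cosh (a * (N + e + 1 / 2))) := by
  have key : ∀ m : ℤ,
      cosh (a * (m + 1 / 2)) / sinh (a * (m + 1 / 2)) - tanh (a * (m + (-N - e : ℝ))) =
      cosh (a * (N + e + 1 / 2)) * (cschCoeff a m * sechCoeff a e (N - m)) := fun m => by
    have hne := sinh_half_odd_ne_zero ha m
    rw [tanh_eq_sinh_div_cosh, cschCoeff, sechCoeff,
      show a * ((N : ℝ) + e + 1 / 2) = a * (m + 1 / 2) - a * (m + (-N - e : ℝ)) by ring,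
      show a * (((N - m : ℤ) : ℝ) + e) = -(a * (m + (-N - e : ℝ))) by push_cast; ring, cosh_neg,
      cosh_sub]
    have := cosh_pos (a * ((m : ℝ) + (-N - e)))
    generalize a * ((m : ℝ) + 1 / 2) = u at *
    field_simp
  have hs := ((expDecay_cschCoeff ha).summable_conv (expDecay_sechCoeff ha e) N).mul_left
    (cosh (a * (N + e + 1 / 2)))
  rw [← funext key] at hs
  have h := tsum_sub_tanh_of_antisymm ha (p := -1) (j := j) (by rw [hj]; push_cast; ring)
    (F := fun m : ℤ => cosh (a * (m + 1 / 2)) / sinh (a * (m + 1 / 2)))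
    (fun m => by
      rw [show a * (((-1 - m : ℤ) : ℝ) + 1 / 2) = -(a * (m + 1 / 2)) by push_cast; ring,
        cosh_neg, sinh_neg, div_neg]) hs
  rw [tsum_congr key, tsum_mul_left] at h
  have := cosh_pos (a * ((N : ℝ) + e + 1 / 2))
  rw [← h]
  field_simp

/-! ### The elliptic functions defined by the trigonometric series -/

/-- Up to scaling, the Jacobi function `cn`. -/
noncomputable def ellC (a x : ℝ) : ℝ := (trigSeries 1 (sechCoeff a (1 / 2)) x).re

/-- Up to scaling, the Jacobi function `sn`. -/
noncomputable def ellS (a x : ℝ) : ℝ := (trigSeries 1 (cschCoeff a) x).im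

/-- Up to scaling, the Jacobi function `dn`. -/
noncomputable def ellD (a x : ℝ) : ℝ := (trigSeries 0 (sechCoeff a 0) x).re

lemma sechCoeff_symm (a : ℝ) (n : ℤ) : sechCoeff a (1 / 2) (-1 - n) = sechCoeff a (1 / 2) n := by
  rw [sechCoeff, sechCoeff, ← cosh_neg]
  congr 2; push_cast; ring

lemma sechCoeff_zero_symm (a : ℝ) (n : ℤ) : sechCoeff a 0 (-0 - n) = sechCoeff a 0 n := by
  rw [sechCoeff, sechCoeff, ← cosh_neg]
  congr 2; push_cast; ring

lemma cschCoeff_antisymm (a : ℝ) (n : ℤ) : cschCoeff a (-1 - n) = -cschCoeff a n := by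
  rw [cschCoeff, cschCoeff, ← div_neg, ← sinh_neg]
  congr 2; push_cast; ring

lemma trigSeries_sech_half (a x : ℝ) : trigSeries 1 (sechCoeff a (1 / 2)) x = ellC a x :=
  trigSeries_of_symm (sechCoeff_symm a) x

lemma trigSeries_csch (a x : ℝ) : trigSeries 1 (cschCoeff a) x = Complex.I * ellS a x :=
  trigSeries_of_antisymm (cschCoeff_antisymm a) x

lemma trigSeries_sech_zero (a x : ℝ) : trigSeries 0 (sechCoeff a 0) x = ellD a x :=
  trigSeries_of_symm (sechCoeff_zero_symm a) x

lemma hasDerivAt_re {f : ℝ → ℂ} {f' : ℂ} {x : ℝ} (h : HasDerivAt f f' x) :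
    HasDerivAt (fun y => (f y).re) f'.re x :=
  Complex.reCLM.hasFDerivAt.comp_hasDerivAt x h

lemma hasDerivAt_im {f : ℝ → ℂ} {f' : ℂ} {x : ℝ} (h : HasDerivAt f f' x) :
    HasDerivAt (fun y => (f y).im) f'.im x :=
  Complex.imCLM.hasFDerivAt.comp_hasDerivAt x h

lemma hasDerivAt_ellS {a : ℝ} (ha : 0 < a) (x : ℝ) :
    HasDerivAt (ellS a) (ellC a x * ellD a x) x := by
  have h := hasDerivAt_im (hasDerivAt_trigSeries (expDecay_cschCoeff ha) 1 x)
  have hm := trigSeries_mul (expDecay_sechCoeff ha (1 / 2)) (expDecay_sechCoeff ha 0) 1 0 x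
  rw [funext (tsum_sech_mul_sech ha), add_zero, trigSeries_sech_half, trigSeries_sech_zero] at hm
  rw [← hm] at h
  exact h.congr_deriv (by simp)

lemma hasDerivAt_ellC {a : ℝ} (ha : 0 < a) (x : ℝ) :
    HasDerivAt (ellC a) (-(ellS a x * ellD a x)) x := by
  have h := hasDerivAt_re (hasDerivAt_trigSeries (expDecay_sechCoeff ha (1 / 2)) 1 x)
  have hm := trigSeries_mul (expDecay_cschCoeff ha) (expDecay_sechCoeff ha 0) 1 0 x
  have hc : ∀ N : ℤ, ∑' m, cschCoeff a m * sechCoeff a 0 (N - m) =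
      ((2 * N + 1 : ℤ) : ℝ) * sechCoeff a (1 / 2) N := fun N => by
    rw [tsum_csch_mul_sech ha (j := 2 * N + 1) N (by push_cast; ring), sechCoeff, add_zero]
  rw [funext hc, add_zero, trigSeries_csch, trigSeries_sech_zero] at hm
  rw [← hm] at h
  exact h.congr_deriv (by simp)

lemma hasDerivAt_ellD {a : ℝ} (ha : 0 < a) (x : ℝ) :
    HasDerivAt (ellD a) (-(ellS a x * ellC a x)) x := by
  have h := hasDerivAt_re (hasDerivAt_trigSeries (expDecay_sechCoeff ha 0) 0 x)
  have hm := trigSeries_mul (expDecay_cschCoeff ha) (expDecay_sechCoeff ha (1 / 2)) 1 1 x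
  have hc : ∀ N : ℤ, ∑' m, cschCoeff a m * sechCoeff a (1 / 2) (N - m) =
      ((2 * (N + 1) + 0 : ℤ) : ℝ) * sechCoeff a 0 (N + 1) := fun N => by
    rw [tsum_csch_mul_sech ha (j := 2 * (N + 1) + 0) N (by push_cast; ring), sechCoeff]
    congr 4
    push_cast; ring
  rw [funext hc, trigSeries_csch, trigSeries_sech_half, show (1 + 1 : ℤ) = 0 + 2 from rfl,
    trigSeries_shift (fun n => ((2 * n + 0 : ℤ) : ℝ) * sechCoeff a 0 n)] at hm
  rw [← hm] at h
  exact h.congr_deriv (by simp)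

lemma continuous_ellS {a : ℝ} (ha : 0 < a) : Continuous (ellS a) :=
  continuous_iff_continuousAt.mpr fun x => (hasDerivAt_ellS ha x).continuousAt

lemma continuous_ellD {a : ℝ} (ha : 0 < a) : Continuous (ellD a) :=
  continuous_iff_continuousAt.mpr fun x => (hasDerivAt_ellD ha x).continuousAt

lemma eq_of_hasDerivAt_zero {f : ℝ → ℝ} (hf : ∀ x, HasDerivAt f 0 x) (x y : ℝ) : f x = f y :=
  is_const_of_deriv_eq_zero (fun x => (hf x).differentiableAt) (fun x => (hf x).deriv) x y

lemma pos_of_hasDerivAt_mul {f g : ℝ → ℝ} (hg : Continuous g)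
    (hf : ∀ x, HasDerivAt f (g x * f x) x) {x₀ : ℝ} (h0 : 0 < f x₀) (x : ℝ) : 0 < f x := by
  have hG : ∀ x, HasDerivAt (fun x => ∫ y in x₀..x, g y) (g x) x := fun x =>
    integral_hasDerivAt_right (hg.intervalIntegrable _ _) (hg.stronglyMeasurableAtFilter _ _)
      hg.continuousAt
  have h := eq_of_hasDerivAt_zero
    (f := fun x => f x * exp (-∫ y in x₀..x, g y)) (fun x => by
      refine ((hf x).mul (hG x).neg.exp).congr_deriv ?_
      ring) x x₀
  simp only [integral_same, neg_zero, exp_zero, mul_one] at h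
  rw [← h] at h0
  exact pos_of_mul_pos_left h0 (exp_pos _).le

lemma ellC_zero (a : ℝ) (ha : 0 < a) : ellC a 0 = ∑' n, sechCoeff a (1 / 2) n := by
  rw [ellC, trigSeries_re (expDecay_sechCoeff ha _).summable_abs]; simp

lemma ellD_zero (a : ℝ) (ha : 0 < a) : ellD a 0 = ∑' n, sechCoeff a 0 n := by
  rw [ellD, trigSeries_re (expDecay_sechCoeff ha _).summable_abs]; simp

lemma ellS_zero (a : ℝ) (ha : 0 < a) : ellS a 0 = 0 := by
  rw [ellS, trigSeries_im (expDecay_cschCoeff ha).summable_abs]; simp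

lemma ellC_pi_div_two (a : ℝ) (ha : 0 < a) : ellC a (π / 2) = 0 := by
  rw [ellC, trigSeries_re (expDecay_sechCoeff ha _).summable_abs]
  refine (tsum_congr fun n => ?_).trans tsum_zero
  rw [Real.cos_eq_zero_iff.mpr ⟨n, by push_cast; ring⟩, mul_zero]

lemma ellC_zero_pos {a : ℝ} (ha : 0 < a) : 0 < ellC a 0 := by
  rw [ellC_zero a ha]
  exact (expDecay_sechCoeff ha _).summable.tsum_pos (fun n => (sechCoeff_pos a _ n).le) 0
    (sechCoeff_pos a _ 0)

lemma one_le_ellD_zero {a : ℝ} (ha : 0 < a) : 1 ≤ ellD a 0 := by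
  rw [ellD_zero a ha]
  have := (expDecay_sechCoeff ha 0).summable.le_tsum 0 (fun n _ => (sechCoeff_pos a _ n).le)
  simpa [sechCoeff] using this

lemma ellD_add_ellC_pos {a : ℝ} (ha : 0 < a) (x : ℝ) : 0 < ellD a x + ellC a x :=
  pos_of_hasDerivAt_mul (f := fun x => ellD a x + ellC a x) (continuous_ellS ha).neg
    (fun x => ((hasDerivAt_ellD ha x).add (hasDerivAt_ellC ha x)).congr_deriv
      (by rw [Pi.neg_apply]; ring)) (x₀ := 0) (by linarith [one_le_ellD_zero ha, ellC_zero_pos ha]) x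

lemma ellD_pi_div_two_pos {a : ℝ} (ha : 0 < a) : 0 < ellD a (π / 2) := by
  simpa [ellC_pi_div_two a ha] using ellD_add_ellC_pos ha (π / 2)

lemma ellC_lt_ellD {a : ℝ} (ha : 0 < a) (x : ℝ) : ellC a x < ellD a x :=
  sub_pos.mp <| pos_of_hasDerivAt_mul (f := fun x => ellD a x - ellC a x) (continuous_ellS ha)
    (fun x => ((hasDerivAt_ellD ha x).sub (hasDerivAt_ellC ha x)).congr_deriv (by ring))
    (x₀ := π / 2) (by simpa [ellC_pi_div_two a ha] using ellD_pi_div_two_pos ha) x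

lemma ellD_pos {a : ℝ} (ha : 0 < a) (x : ℝ) : 0 < ellD a x := by
  linarith [ellD_add_ellC_pos ha x, ellC_lt_ellD ha x]

lemma ellD_sq {a : ℝ} (ha : 0 < a) (x : ℝ) : ellD a x ^ 2 = ellD a 0 ^ 2 - ellS a x ^ 2 := by
  have h := eq_of_hasDerivAt_zero (f := fun x => ellD a x ^ 2 + ellS a x ^ 2) (fun x => by
    refine (((hasDerivAt_ellD ha x).pow 2).add ((hasDerivAt_ellS ha x).pow 2)).congr_deriv ?_
    push_cast; ring) x 0
  simp only [ellS_zero a ha] at h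
  linarith

/-- The amplitude function `∫₀ˣ ellD a`. -/
noncomputable def ellAm (a x : ℝ) : ℝ := ∫ y in (0 : ℝ)..x, ellD a y

lemma hasDerivAt_ellAm {a : ℝ} (ha : 0 < a) (x : ℝ) : HasDerivAt (ellAm a) (ellD a x) x :=
  integral_hasDerivAt_right ((continuous_ellD ha).intervalIntegrable _ _)
    ((continuous_ellD ha).stronglyMeasurableAtFilter _ _) (continuous_ellD ha).continuousAt

lemma ellAm_zero (a : ℝ) : ellAm a 0 = 0 := integral_same

lemma ellC_cos_add_ellS_sin {a : ℝ} (ha : 0 < a) (x : ℝ) :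
    ellC a x * cos (ellAm a x) + ellS a x * sin (ellAm a x) = ellC a 0 := by
  have h := eq_of_hasDerivAt_zero
    (f := fun x => ellC a x * cos (ellAm a x) + ellS a x * sin (ellAm a x)) (fun x => by
    refine (((hasDerivAt_ellC ha x).mul (hasDerivAt_ellAm ha x).cos).add
      ((hasDerivAt_ellS ha x).mul (hasDerivAt_ellAm ha x).sin)).congr_deriv ?_
    ring) x 0
  simpa [ellAm_zero, ellS_zero a ha] using h

lemma ellS_cos_sub_ellC_sin {a : ℝ} (ha : 0 < a) (x : ℝ) :
    ellS a x * cos (ellAm a x) - ellC a x * sin (ellAm a x) = 0 := by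
  have h := eq_of_hasDerivAt_zero
    (f := fun x => ellS a x * cos (ellAm a x) - ellC a x * sin (ellAm a x)) (fun x => by
    refine (((hasDerivAt_ellS ha x).mul (hasDerivAt_ellAm ha x).cos).sub
      ((hasDerivAt_ellC ha x).mul (hasDerivAt_ellAm ha x).sin)).congr_deriv ?_
    ring) x 0
  simpa [ellAm_zero, ellS_zero a ha] using h

lemma ellC_eq {a : ℝ} (ha : 0 < a) (x : ℝ) : ellC a x = ellC a 0 * cos (ellAm a x) := by
  linear_combination cos (ellAm a x) * ellC_cos_add_ellS_sin ha x -
    sin (ellAm a x) * ellS_cos_sub_ellC_sin ha x - ellC a x * sin_sq_add_cos_sq (ellAm a x)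

lemma ellS_eq {a : ℝ} (ha : 0 < a) (x : ℝ) : ellS a x = ellC a 0 * sin (ellAm a x) := by
  linear_combination sin (ellAm a x) * ellC_cos_add_ellS_sin ha x +
    cos (ellAm a x) * ellS_cos_sub_ellC_sin ha x - ellS a x * sin_sq_add_cos_sq (ellAm a x)

lemma strictMono_ellAm {a : ℝ} (ha : 0 < a) : StrictMono (ellAm a) :=
  strictMono_of_hasDerivAt_pos (hasDerivAt_ellAm ha) (ellD_pos ha)

lemma ellD_eq_tsum {a : ℝ} (ha : 0 < a) (x : ℝ) :
    ellD a x = 1 + ∑' m : ℕ, 2 * sechCoeff a 0 (m + 1) * cos (2 * (m + 1) * x) := by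
  have hdec := expDecay_sechCoeff ha 0
  rw [ellD, trigSeries_re hdec.summable_abs]
  set f : ℤ → ℝ := fun n => sechCoeff a 0 n * cos (((2 * n + 0 : ℤ) : ℝ) * x) with hf
  have hs : Summable f := Summable.of_norm_bounded hdec.summable_abs fun n => by
    rw [hf, norm_mul, Real.norm_eq_abs, Real.norm_eq_abs]
    exact mul_le_of_le_one_right (abs_nonneg _) (abs_cos_le_one _)
  have h1 : Summable fun n : ℕ => f n := hs.comp_injective Nat.cast_injective
  have h2 : Summable fun n : ℕ => f (-((n : ℤ) + 1)) :=
    hs.comp_injective (i := fun n : ℕ => -((n : ℤ) + 1)) (fun x y hxy => by simpa using hxy)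
  rw [tsum_of_nat_of_neg_add_one h1 h2, h1.tsum_eq_zero_add, add_assoc,
    ← ((summable_nat_add_iff 1).mpr h1).tsum_add h2]
  congr 1
  · simp [hf, sechCoeff]
  · refine tsum_congr fun m => ?_
    have e1 : sechCoeff a 0 (-((m : ℤ) + 1)) = sechCoeff a 0 (m + 1) := by
      simpa using sechCoeff_zero_symm a (m + 1)
    simp only [hf, e1]
    rw [← cos_neg (((2 * (-((m : ℤ) + 1)) + 0 : ℤ) : ℝ) * x)]
    push_cast
    ring_nf

lemma hasSum_integral_tsum_mul {b : ℕ → ℝ} (hb : Summable fun m => |b m|) {φ : ℕ → ℝ → ℝ}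
    (hφ : ∀ m, Continuous (φ m)) (hφ1 : ∀ m x, |φ m x| ≤ 1) {w : ℝ → ℝ} (hw : Continuous w)
    (u v : ℝ) :
    HasSum (fun m => b m * ∫ x in u..v, φ m x * w x) (∫ x in u..v, (∑' m, b m * φ m x) * w x) := by
  have hle : ∀ m x, |b m * φ m x| ≤ |b m| := fun m x => by
    rw [abs_mul]; exact mul_le_of_le_one_right (abs_nonneg _) (hφ1 m x)
  have hsum : ∀ x, HasSum (fun m => b m * φ m x) (∑' m, b m * φ m x) := fun x =>
    (Summable.of_abs (Summable.of_nonneg_of_le (fun _ => abs_nonneg _) (fun m => hle m x)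
      hb)).hasSum
  have h : HasSum (fun m => ∫ x in u..v, b m * φ m x * w x)
      (∫ x in u..v, (∑' m, b m * φ m x) * w x) := by
    refine intervalIntegral.hasSum_integral_of_dominated_convergence
      (fun m x => |b m| * |w x|) (fun m => ?_) (fun m => ?_) ?_ ?_ ?_
    · exact (((hφ m).const_mul _).mul hw).aestronglyMeasurable
    · refine ae_of_all _ fun x _ => ?_
      rw [norm_mul]
      exact mul_le_mul_of_nonneg_right (hle m x) (abs_nonneg _)
    · exact ae_of_all _ fun x _ => hb.mul_right _
    · simp only [tsum_mul_right]
      exact Continuous.intervalIntegrable (by fun_prop) _ _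
    · exact ae_of_all _ fun x _ => (hsum x).mul_right (w x)
  simpa only [mul_assoc, intervalIntegral.integral_const_mul] using h

lemma summable_abs_two_mul_sechCoeff {a : ℝ} (ha : 0 < a) :
    Summable fun m : ℕ => |2 * sechCoeff a 0 (m + 1)| := by
  have h := (expDecay_sechCoeff ha 0).summable_abs.comp_injective
    (i := fun m : ℕ => (m : ℤ) + 1) (fun x y hxy => by simpa using hxy)
  simpa only [abs_mul, Function.comp_apply] using h.mul_left |(2 : ℝ)|

lemma integral_ellD_mul {a : ℝ} (ha : 0 < a) {w : ℝ → ℝ} (hw : Continuous w) :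
    ∫ x in (0 : ℝ)..π / 2, ellD a x * w x = (∫ x in (0 : ℝ)..π / 2, w x) +
      ∑' m : ℕ, 2 * sechCoeff a 0 (m + 1) *
        ∫ x in (0 : ℝ)..π / 2, cos (2 * (m + 1) * x) * w x := by
  have hs := hasSum_integral_tsum_mul (summable_abs_two_mul_sechCoeff ha)
    (φ := fun m x => cos (2 * (m + 1) * x)) (fun m => by fun_prop)
    (fun m x => abs_cos_le_one _) hw 0 (π / 2)
  have e : ∀ x, (∑' m : ℕ, 2 * sechCoeff a 0 (m + 1) * cos (2 * (m + 1) * x)) * w x =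
      ellD a x * w x - w x := fun x => by rw [ellD_eq_tsum ha]; ring
  simp only [e] at hs
  rw [intervalIntegral.integral_sub (Continuous.intervalIntegrable
    (by have := continuous_ellD ha; fun_prop) _ _) (hw.intervalIntegrable _ _)] at hs
  rw [hs.tsum_eq]
  ring

lemma ellAm_pi_div_two {a : ℝ} (ha : 0 < a) : ellAm a (π / 2) = π / 2 := by
  have h := integral_ellD_mul ha (w := fun _ => 1) continuous_const
  have h0 : ∀ m : ℕ, ∫ x in (0 : ℝ)..π / 2, cos (2 * ((m : ℝ) + 1) * x) = 0 := fun m => by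
    rw [intervalIntegral.integral_comp_mul_left (fun y => cos y) (by positivity), integral_cos,
      show 2 * ((m : ℝ) + 1) * (π / 2) = ((m + 1 : ℕ) : ℝ) * π by push_cast; ring, sin_nat_mul_pi]
    simp
  simpa only [mul_one, h0, mul_zero, tsum_zero, add_zero, ellAm, sub_zero,
    intervalIntegral.integral_const, smul_eq_mul]
    using h

/-! ### The complete elliptic integral and the amplitude integral -/

/-- The elliptic modulus attached to the nome `e^{-a}`. -/
noncomputable def ellModulus (a : ℝ) : ℝ := ellC a 0 / ellD a 0

lemma ellModulus_pos {a : ℝ} (ha : 0 < a) : 0 < ellModulus a :=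
  div_pos (ellC_zero_pos ha) (ellD_pos ha 0)

lemma ellModulus_lt_one {a : ℝ} (ha : 0 < a) : ellModulus a < 1 :=
  (div_lt_one (ellD_pos ha 0)).mpr (ellC_lt_ellD ha 0)

lemma one_sub_modulus_sq_mul_sin_sq {a : ℝ} (ha : 0 < a) (x : ℝ) :
    1 - ellModulus a ^ 2 * sin (ellAm a x) ^ 2 = (ellD a x / ellD a 0) ^ 2 := by
  have h := ellD_sq ha x
  rw [ellS_eq ha] at h
  have := (ellD_pos ha 0).ne'
  rw [div_pow, h, ellModulus]
  field_simp

lemma ellAm_mem_Ioo {a : ℝ} (ha : 0 < a) {x : ℝ} (hx : x ∈ Set.Ioo 0 (π / 2)) :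
    ellAm a x ∈ Set.Ioo 0 (π / 2) := by
  have h1 := strictMono_ellAm ha hx.1
  have h2 := strictMono_ellAm ha hx.2
  rw [ellAm_zero] at h1
  rw [ellAm_pi_div_two ha] at h2
  exact ⟨h1, h2⟩

lemma image_sin_ellAm {a : ℝ} (ha : 0 < a) :
    (fun x => sin (ellAm a x)) '' Set.Ioo 0 (π / 2) = Set.Ioo 0 1 := by
  apply Set.Subset.antisymm
  · rintro _ ⟨x, hx, rfl⟩
    have h := ellAm_mem_Ioo ha hx
    refine ⟨sin_pos_of_pos_of_lt_pi h.1 (by linarith [h.2, pi_pos]), ?_⟩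
    have := sin_lt_sin_of_lt_of_le_pi_div_two (by linarith [h.1, pi_pos]) le_rfl h.2
    rwa [sin_pi_div_two] at this
  · have hc : Continuous fun x => sin (ellAm a x) := continuous_iff_continuousAt.mpr
      fun x => (hasDerivAt_ellAm ha x).sin.continuousAt
    have := intermediate_value_Ioo pi_div_two_pos.le hc.continuousOn
    simpa only [ellAm_zero, ellAm_pi_div_two ha, sin_zero, sin_pi_div_two] using this

/-- The complete elliptic integral of the first kind at `ellModulus a`. -/
lemma integral_ellModulus {a : ℝ} (ha : 0 < a) :
    ∫ z in (0 : ℝ)..1, 1 / √((1 - z ^ 2) * (1 - ellModulus a ^ 2 * z ^ 2)) =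
      π / 2 * ellD a 0 := by
  rw [intervalIntegral.integral_of_le zero_le_one, integral_Ioc_eq_integral_Ioo,
    ← image_sin_ellAm ha,
    integral_image_eq_integral_abs_deriv_smul measurableSet_Ioo
      (fun x _ => (hasDerivAt_ellAm ha x).sin.hasDerivWithinAt)]
  · have : Set.EqOn (fun x => |cos (ellAm a x) * ellD a x| •
        (1 / √((1 - sin (ellAm a x) ^ 2) * (1 - ellModulus a ^ 2 * sin (ellAm a x) ^ 2))))
        (fun _ => ellD a 0) (Set.Ioo 0 (π / 2)) := fun x hx => by
      have h := ellAm_mem_Ioo ha hx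
      have hcos : 0 < cos (ellAm a x) := cos_pos_of_mem_Ioo ⟨by linarith [h.1, pi_pos], h.2⟩
      have h0 := ellD_pos ha 0
      have hD := ellD_pos ha x
      simp only [smul_eq_mul]
      rw [one_sub_modulus_sq_mul_sin_sq ha, ← cos_sq', ← mul_pow, sqrt_sq (by positivity),
        abs_of_pos (by positivity)]
      field_simp
    rw [setIntegral_congr_fun measurableSet_Ioo this, setIntegral_const, smul_eq_mul]
    simp [pi_div_two_pos.le]
  · intro x hx y hy hxy
    have h1 := ellAm_mem_Ioo ha hx
    have h2 := ellAm_mem_Ioo ha hy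
    exact (strictMono_ellAm ha).injective (injOn_sin
      ⟨by linarith [h1.1, pi_pos], h1.2.le⟩ ⟨by linarith [h2.1, pi_pos], h2.2.le⟩ hxy)

/-- The primitive of `ellC` that vanishes at `0`. -/
noncomputable def ellP (a x : ℝ) : ℝ :=
  (trigSeries 1 (fun n => sechCoeff a (1 / 2) n / ((2 * n + 1 : ℤ) : ℝ)) x).im

lemma odd_cast_ne_zero (n : ℤ) : ((2 * n + 1 : ℤ) : ℝ) ≠ 0 := by
  exact_mod_cast (by omega : 2 * n + 1 ≠ 0)

lemma one_le_abs_odd_cast (n : ℤ) : 1 ≤ |((2 * n + 1 : ℤ) : ℝ)| := by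
  exact_mod_cast Int.one_le_abs (by omega : 2 * n + 1 ≠ 0)

lemma expDecay_sechCoeff_div {a : ℝ} (ha : 0 < a) :
    ExpDecay fun n => sechCoeff a (1 / 2) n / ((2 * n + 1 : ℤ) : ℝ) := by
  obtain ⟨B, r, h0, h1, h⟩ := expDecay_sechCoeff ha (1 / 2)
  refine ⟨B, r, h0, h1, fun n => le_trans ?_ (h n)⟩
  rw [abs_div]
  exact div_le_self (abs_nonneg _) (one_le_abs_odd_cast n)

lemma hasDerivAt_ellP {a : ℝ} (ha : 0 < a) (x : ℝ) : HasDerivAt (ellP a) (ellC a x) x := by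
  have h := hasDerivAt_im (hasDerivAt_trigSeries (expDecay_sechCoeff_div ha) 1 x)
  have e : (fun n : ℤ => ((2 * n + 1 : ℤ) : ℝ) *
      (sechCoeff a (1 / 2) n / ((2 * n + 1 : ℤ) : ℝ))) = sechCoeff a (1 / 2) :=
    funext fun n => mul_div_cancel₀ _ (odd_cast_ne_zero n)
  rw [e, trigSeries_sech_half] at h
  exact h.congr_deriv (by simp)

lemma abs_modulus_mul_sin_lt_one {a : ℝ} (ha : 0 < a) (y : ℝ) : |ellModulus a * sin y| < 1 := by
  rw [abs_mul, abs_of_pos (ellModulus_pos ha)]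
  exact lt_of_le_of_lt (mul_le_of_le_one_right (ellModulus_pos ha).le (abs_sin_le_one y))
    (ellModulus_lt_one ha)

lemma ellP_eq_arcsin {a : ℝ} (ha : 0 < a) (x : ℝ) :
    ellP a x = arcsin (ellModulus a * sin (ellAm a x)) := by
  have h := eq_of_hasDerivAt_zero
    (f := fun x => ellP a x - arcsin (ellModulus a * sin (ellAm a x))) (fun x => by
    have hlt := abs_lt.mp (abs_modulus_mul_sin_lt_one ha (ellAm a x))
    have h1 := (hasDerivAt_arcsin hlt.1.ne' hlt.2.ne).comp x
      ((hasDerivAt_ellAm ha x).sin.const_mul (ellModulus a))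
    refine ((hasDerivAt_ellP ha x).sub h1).congr_deriv ?_
    have h0 := ellD_pos ha 0
    have hD := ellD_pos ha x
    rw [mul_pow, one_sub_modulus_sq_mul_sin_sq ha, sqrt_sq (by positivity), ellC_eq ha x,
      ellModulus]
    field_simp
    ring) x 0
  have h0 : ellP a 0 = 0 := by
    rw [ellP, trigSeries_im (expDecay_sechCoeff_div ha).summable_abs]; simp
  simp only [h0, ellAm_zero, sin_zero, mul_zero, arcsin_zero, sub_zero] at h
  linarith

lemma integral_ellP_mul_ellD {a : ℝ} (ha : 0 < a) :
    ∫ x in (0 : ℝ)..π / 2, ellP a x * ellD a x =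
      ∫ y in (0 : ℝ)..π / 2, arcsin (ellModulus a * sin y) := by
  have h := intervalIntegral.integral_comp_mul_deriv (a := 0) (b := π / 2)
    (g := fun y => arcsin (ellModulus a * sin y)) (fun x _ => hasDerivAt_ellAm ha x)
    (continuous_ellD ha).continuousOn (by have := continuous_arcsin; fun_prop)
  rw [ellAm_zero, ellAm_pi_div_two ha] at h
  rw [← h]
  refine intervalIntegral.integral_congr fun x _ => ?_
  simp only [Function.comp_apply, ellP_eq_arcsin ha]

lemma ellP_eq_tsum {a : ℝ} (ha : 0 < a) (x : ℝ) :
    ellP a x = ∑' n : ℕ, 2 * sechCoeff a (1 / 2) n / (2 * n + 1) * sin ((2 * n + 1) * x) := by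
  have hdec := expDecay_sechCoeff_div ha
  rw [ellP, trigSeries_im hdec.summable_abs]
  set f : ℤ → ℝ := fun n => sechCoeff a (1 / 2) n / ((2 * n + 1 : ℤ) : ℝ) *
    sin (((2 * n + 1 : ℤ) : ℝ) * x) with hf
  have hs : Summable f := Summable.of_norm_bounded hdec.summable_abs fun n => by
    rw [hf, norm_mul, Real.norm_eq_abs, Real.norm_eq_abs]
    exact mul_le_of_le_one_right (abs_nonneg _) (abs_sin_le_one _)
  have h1 : Summable fun n : ℕ => f n := hs.comp_injective Nat.cast_injective
  have h2 : Summable fun n : ℕ => f (-((n : ℤ) + 1)) :=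
    hs.comp_injective (i := fun n : ℕ => -((n : ℤ) + 1)) (fun x y hxy => by simpa using hxy)
  rw [tsum_of_nat_of_neg_add_one h1 h2, ← h1.tsum_add h2]
  refine tsum_congr fun m => ?_
  have e1 : sechCoeff a (1 / 2) (-((m : ℤ) + 1)) = sechCoeff a (1 / 2) m := by
    rw [← sechCoeff_symm a m]; congr 1; ring
  simp only [hf, e1]
  rw [show ((2 * (-((m : ℤ) + 1)) + 1 : ℤ) : ℝ) = -(2 * m + 1) by push_cast; ring,
    show ((2 * (m : ℤ) + 1 : ℤ) : ℝ) = 2 * m + 1 by push_cast; ring, neg_mul, sin_neg, div_neg]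
  ring

lemma integral_cos_even_mul_sin_odd (n r : ℕ) :
    ∫ x in (0 : ℝ)..π / 2, cos (2 * r * x) * sin ((2 * n + 1) * x) =
      (2 * n + 1) / ((2 * n + 1 : ℝ) ^ 2 - (2 * r) ^ 2) := by
  have hne : (2 * n + 1 : ℝ) ^ 2 - (2 * r) ^ 2 ≠ 0 := by
    have : (2 * n + 1 : ℤ) ^ 2 - (2 * r) ^ 2 ≠ 0 := fun h => by
      rw [sq_sub_sq, mul_eq_zero] at h
      omega
    exact_mod_cast this
  set P : ℝ := 2 * n + 1 with hP
  set R : ℝ := 2 * r with hR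
  have hd : ∀ x : ℝ, HasDerivAt
      (fun x => -(P * (cos (P * x) * cos (R * x)) + R * (sin (P * x) * sin (R * x))) /
        (P ^ 2 - R ^ 2)) (cos (R * x) * sin (P * x)) x := fun x => by
    have hp : HasDerivAt (fun x => P * x) P x := by simpa using (hasDerivAt_id x).const_mul P
    have hr : HasDerivAt (fun x => R * x) R x := by simpa using (hasDerivAt_id x).const_mul R
    refine ((((hp.cos.mul hr.cos).const_mul P).add
      ((hp.sin.mul hr.sin).const_mul R)).neg.div_const _).congr_deriv ?_
    rw [div_eq_iff hne]
    ring
  rw [intervalIntegral.integral_eq_sub_of_hasDerivAt (fun x _ => hd x)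
    (Continuous.intervalIntegrable (by fun_prop) _ _)]
  have c0 : cos (P * (π / 2)) = 0 :=
    Real.cos_eq_zero_iff.mpr ⟨n, by rw [hP]; push_cast; ring⟩
  have s0 : sin (R * (π / 2)) = 0 := by
    rw [hR, show 2 * (r : ℝ) * (π / 2) = r * π by ring, sin_nat_mul_pi]
  simp only [c0, s0]
  simp [neg_div]

lemma summable_abs_two_mul_sechCoeff_half_div {a : ℝ} (ha : 0 < a) :
    Summable fun n : ℕ => |2 * sechCoeff a (1 / 2) n / (2 * n + 1)| := by
  have h := (expDecay_sechCoeff_div ha).summable_abs.comp_injective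
    (i := fun m : ℕ => (m : ℤ)) Nat.cast_injective
  refine (h.mul_left |(2 : ℝ)|).congr fun n => ?_
  rw [Function.comp_apply, ← abs_mul, mul_div_assoc]
  push_cast
  rfl

lemma hasSum_integral_arcsin {a : ℝ} (ha : 0 < a) :
    HasSum (fun n : ℕ => 2 * sechCoeff a (1 / 2) n / (2 * n + 1) * (1 / (2 * n + 1) +
      ∑' m : ℕ, 2 * sechCoeff a 0 (m + 1) *
        ((2 * n + 1) / ((2 * n + 1 : ℝ) ^ 2 - (2 * (m + 1)) ^ 2))))
      (∫ y in (0 : ℝ)..π / 2, arcsin (ellModulus a * sin y)) := by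
  have hs := hasSum_integral_tsum_mul (summable_abs_two_mul_sechCoeff_half_div ha)
    (φ := fun n x => sin ((2 * n + 1) * x)) (fun m => by fun_prop)
    (fun m x => abs_sin_le_one _) (continuous_ellD ha) 0 (π / 2)
  simp only [← ellP_eq_tsum ha] at hs
  rw [integral_ellP_mul_ellD ha] at hs
  convert! hs using 1
  ext n
  congr 1
  simp only [mul_comm (sin _)]
  rw [integral_ellD_mul ha (by fun_prop)]
  have h0 := integral_cos_even_mul_sin_odd n 0
  simp only [Nat.cast_zero, mul_zero, zero_mul, cos_zero, one_mul] at h0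
  rw [h0]
  congr 1
  · have : (2 * n + 1 : ℝ) ≠ 0 := by positivity
    field_simp
    ring
  · refine tsum_congr fun m => ?_
    have h1 := integral_cos_even_mul_sin_odd n (m + 1)
    push_cast at h1
    rw [h1]

/-! ### The integral of `arcsin (k sin y)` as a dilogarithm -/

lemma hasDerivAt_integral_arcsin {k : ℝ} (h0 : 0 ≤ k) (h1 : k < 1) :
    HasDerivAt (fun s => ∫ y in (0 : ℝ)..π / 2, arcsin (s * sin y))
      (∫ y in (0 : ℝ)..π / 2, sin y / √(1 - k ^ 2 * sin y ^ 2)) k := by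
  obtain ⟨r, hr, hr1⟩ := exists_between h1
  have hr0 : 0 < r := h0.trans_lt hr
  have hpos : ∀ s ∈ Set.Ioo (-r) r, ∀ y, 1 - r ^ 2 ≤ 1 - s ^ 2 * sin y ^ 2 := fun s hs y => by
    have : s ^ 2 ≤ r ^ 2 := sq_le_sq' hs.1.le hs.2.le
    nlinarith [sin_sq_le_one y, sq_nonneg (sin y), sq_nonneg s]
  have hr2 : 0 < 1 - r ^ 2 := by nlinarith
  refine (intervalIntegral.hasDerivAt_integral_of_dominated_loc_of_deriv_le
    (s := Set.Ioo (-r) r) (F := fun s y => arcsin (s * sin y))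
    (F' := fun s y => sin y / √(1 - s ^ 2 * sin y ^ 2)) (bound := fun _ => 1 / √(1 - r ^ 2))
    (Ioo_mem_nhds (by linarith) hr) (Filter.Eventually.of_forall fun s => ?_) ?_ ?_ ?_ ?_ ?_).2
  · exact (continuous_arcsin.comp (by fun_prop)).aestronglyMeasurable
  · exact (continuous_arcsin.comp (by fun_prop)).intervalIntegrable _ _
  · exact Measurable.aestronglyMeasurable (by fun_prop)
  · refine ae_of_all _ fun y _ s hs => ?_
    rw [norm_div, Real.norm_eq_abs, Real.norm_of_nonneg (sqrt_nonneg _)]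
    exact div_le_div₀ zero_le_one (abs_sin_le_one y) (sqrt_pos.mpr hr2)
      (sqrt_le_sqrt (hpos s hs y))
  · exact intervalIntegrable_const
  · refine ae_of_all _ fun y _ s hs => ?_
    have hlt : (s * sin y) ^ 2 < 1 := by
      have := hpos s hs y
      rw [mul_pow]; linarith
    have hab := abs_lt.mp ((sq_lt_one_iff_abs_lt_one _).mp hlt)
    have h := (hasDerivAt_arcsin hab.1.ne' hab.2.ne).comp s ((hasDerivAt_id s).mul_const (sin y))
    refine h.congr_deriv ?_
    rw [mul_pow]
    simp [div_eq_inv_mul]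

lemma integral_sin_div_sqrt {k : ℝ} (h0 : 0 < k) (h1 : k < 1) :
    ∫ y in (0 : ℝ)..π / 2, sin y / √(1 - k ^ 2 * sin y ^ 2) =
      (log (1 + k) - log (1 - k)) / (2 * k) := by
  have hk2 : 0 < 1 - k ^ 2 := by nlinarith
  set c := √(1 - k ^ 2) with hc
  have hc0 : 0 < c := sqrt_pos.mpr hk2
  have hcsq : c ^ 2 = 1 - k ^ 2 := sq_sqrt hk2.le
  have hpos : ∀ y, 0 < 1 - k ^ 2 * sin y ^ 2 := fun y => by
    nlinarith [sin_sq_le_one y, sq_nonneg (sin y), sq_nonneg k]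
  have hd : ∀ y, HasDerivAt (fun y => -(arsinh (k / c * cos y) / k))
      (sin y / √(1 - k ^ 2 * sin y ^ 2)) y := fun y => by
    have h := ((hasDerivAt_arsinh (k / c * cos y)).comp y
      ((hasDerivAt_cos y).const_mul (k / c))).div_const k |>.neg
    refine h.congr_deriv ?_
    have e : 1 + (k / c * cos y) ^ 2 = (1 - k ^ 2 * sin y ^ 2) / c ^ 2 := by
      rw [sin_sq, eq_div_iff (by positivity), mul_pow, div_pow]
      field_simp
      rw [hcsq]; ring
    rw [e, sqrt_div (hpos y).le, sqrt_sq hc0.le]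
    have := sqrt_pos.mpr (hpos y)
    field_simp
  have hcont : Continuous fun y => sin y / √(1 - k ^ 2 * sin y ^ 2) :=
    Continuous.div (by fun_prop) (by fun_prop) fun y => (sqrt_pos.mpr (hpos y)).ne'
  rw [intervalIntegral.integral_eq_sub_of_hasDerivAt (fun y _ => hd y)
    (hcont.intervalIntegrable _ _)]
  have e2 : arsinh (k / c) = (log (1 + k) - log (1 - k)) / 2 := by
    have e3 : √(1 + (k / c) ^ 2) = 1 / c := by
      rw [show 1 + (k / c) ^ 2 = (1 / c) ^ 2 by field_simp; rw [hcsq]; ring,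
        sqrt_sq (by positivity)]
    rw [arsinh, e3, ← add_div, log_div (by positivity) hc0.ne', hc, log_sqrt hk2.le,
      show 1 - k ^ 2 = (1 + k) * (1 - k) by ring,
      log_mul (by positivity) (by linarith), add_comm k]
    ring
  simp only [cos_pi_div_two, mul_zero, arsinh_zero, cos_zero, mul_one, e2]
  field_simp
  ring

lemma summable_odd_dilog_terms {k : ℝ} (hk : |k| < 1) :
    Summable fun n : ℕ => k ^ (2 * n + 1) / (2 * n + 1 : ℝ) ^ 2 := by
  have hg : Summable fun n : ℕ => (|k| ^ 2) ^ n :=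
    summable_geometric_of_lt_one (by positivity) (by nlinarith [abs_nonneg k])
  refine Summable.of_norm_bounded (hg.mul_left |k|) fun n => ?_
  rw [norm_div, norm_pow, Real.norm_eq_abs, ← pow_mul, ← pow_succ']
  refine div_le_self (by positivity) ?_
  rw [Real.norm_of_nonneg (by positivity)]
  have : (0 : ℝ) ≤ n := by positivity
  nlinarith

lemma hasDerivAt_odd_dilog {k : ℝ} (h0 : 0 ≤ k) (h1 : k < 1) :
    HasDerivAt (fun s : ℝ => ∑' n : ℕ, s ^ (2 * n + 1) / (2 * n + 1 : ℝ) ^ 2)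
      (∑' n : ℕ, k ^ (2 * n) / (2 * n + 1 : ℝ)) k := by
  obtain ⟨r, hr, hr1⟩ := exists_between h1
  have hr0 : 0 < r := h0.trans_lt hr
  have hu : Summable fun n : ℕ => (r ^ 2) ^ n :=
    summable_geometric_of_lt_one (by positivity) (by nlinarith)
  refine hasDerivAt_tsum_of_isPreconnected hu (t := Set.Ioo (-r) r) isOpen_Ioo isPreconnected_Ioo
    (g := fun (n : ℕ) (s : ℝ) => s ^ (2 * n + 1) / (2 * n + 1 : ℝ) ^ 2)
    (g' := fun (n : ℕ) (s : ℝ) => s ^ (2 * n) / (2 * n + 1 : ℝ))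
    (fun n s _ => ?_) (fun n s hs => ?_) (y₀ := k) ⟨by linarith, hr⟩
    (summable_odd_dilog_terms (by rwa [abs_of_nonneg h0])) ⟨by linarith, hr⟩
  · refine ((hasDerivAt_pow (2 * n + 1) s).div_const _).congr_deriv ?_
    have : (2 * n + 1 : ℝ) ≠ 0 := by positivity
    push_cast
    field_simp
  · rw [norm_div, norm_pow, ← pow_mul, Real.norm_of_nonneg (by positivity : (0 : ℝ) ≤ 2 * n + 1)]
    refine (div_le_self (by positivity) (by linarith [Nat.cast_nonneg (α := ℝ) n])).trans ?_
    exact pow_le_pow_left₀ (norm_nonneg _) (abs_le.mpr ⟨hs.1.le, hs.2.le⟩) _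

lemma tsum_pow_even_div_odd {k : ℝ} (h0 : 0 < k) (h1 : k < 1) :
    ∑' n : ℕ, k ^ (2 * n) / (2 * n + 1 : ℝ) = (log (1 + k) - log (1 - k)) / (2 * k) := by
  have h := (hasSum_log_sub_log_of_abs_lt_one (by rwa [abs_of_pos h0])).div_const (2 * k)
  rw [← h.tsum_eq]
  refine tsum_congr fun n => ?_
  have : (2 * n + 1 : ℝ) ≠ 0 := by positivity
  field_simp
  ring

lemma integral_arcsin_mul_sin {k : ℝ} (h0 : 0 < k) (h1 : k < 1) :
    ∫ y in (0 : ℝ)..π / 2, arcsin (k * sin y) =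
      ∑' n : ℕ, k ^ (2 * n + 1) / (2 * n + 1 : ℝ) ^ 2 := by
  have hd : ∀ s, 0 ≤ s → s < 1 → HasDerivAt
      (fun s => (∫ y in (0 : ℝ)..π / 2, arcsin (s * sin y)) -
        ∑' n : ℕ, s ^ (2 * n + 1) / (2 * n + 1 : ℝ) ^ 2) _ s := fun s hs0 hs1 =>
    (hasDerivAt_integral_arcsin hs0 hs1).sub (hasDerivAt_odd_dilog hs0 hs1)
  obtain ⟨s, hs, h⟩ := exists_hasDerivAt_eq_slope _ _ h0
    (fun s hs => (hd s hs.1 (hs.2.trans_lt h1)).continuousAt.continuousWithinAt)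
    (fun s hs => hd s hs.1.le (hs.2.trans h1))
  rw [integral_sin_div_sqrt hs.1 (hs.2.trans h1), tsum_pow_even_div_odd hs.1 (hs.2.trans h1),
    sub_self, eq_comm, div_eq_zero_iff] at h
  simp only [zero_mul, arcsin_zero, intervalIntegral.integral_zero, sub_zero, ne_eq,
    Nat.add_eq_zero_iff, one_ne_zero, and_false, not_false_eq_true, zero_pow, zero_div,
    tsum_zero, h0.ne', or_false] at h
  linarith

lemma summable_dilog_terms {z : ℝ} (hz : |z| < 1) :
    Summable fun n : ℕ => z ^ (n + 1) / ((n + 1 : ℕ) : ℝ) ^ 2 := by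
  refine Summable.of_norm_bounded
    ((summable_geometric_of_lt_one (abs_nonneg z) hz).mul_left |z|) fun n => ?_
  rw [norm_div, norm_pow, Real.norm_eq_abs, ← pow_succ']
  refine div_le_self (by positivity) ?_
  rw [Real.norm_of_nonneg (by positivity)]
  push_cast
  have : (0 : ℝ) ≤ n := by positivity
  nlinarith

lemma Li2_sub_Li2_neg {k : ℝ} (hk : |k| < 1) :
    Li2 k - Li2 (-k) = 2 * ∑' n : ℕ, k ^ (2 * n + 1) / (2 * n + 1 : ℝ) ^ 2 := by
  have hs1 := summable_dilog_terms hk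
  have hs2 := summable_dilog_terms (z := -k) (by rwa [abs_neg])
  have heven : HasSum (fun n : ℕ => k ^ (2 * n + 1) / ((2 * n + 1 : ℕ) : ℝ) ^ 2 -
      (-k) ^ (2 * n + 1) / ((2 * n + 1 : ℕ) : ℝ) ^ 2)
      (2 * ∑' n : ℕ, k ^ (2 * n + 1) / (2 * n + 1 : ℝ) ^ 2) := by
    refine ((summable_odd_dilog_terms hk).hasSum.mul_left 2).congr_fun fun n => ?_
    rw [Odd.neg_pow ⟨n, rfl⟩]
    push_cast
    ring
  have hodd : HasSum (fun n : ℕ => k ^ (2 * n + 1 + 1) / ((2 * n + 1 + 1 : ℕ) : ℝ) ^ 2 -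
      (-k) ^ (2 * n + 1 + 1) / ((2 * n + 1 + 1 : ℕ) : ℝ) ^ 2) 0 := by
    refine hasSum_zero.congr_fun fun n => ?_
    rw [Even.neg_pow ⟨n + 1, by ring⟩, sub_self]
  have h := HasSum.even_add_odd (f := fun n : ℕ => k ^ (n + 1) / ((n + 1 : ℕ) : ℝ) ^ 2 -
      (-k) ^ (n + 1) / ((n + 1 : ℕ) : ℝ) ^ 2) heven hodd
  rw [Li2, Li2, ← hs1.tsum_sub hs2, h.tsum_eq, add_zero]

/-! ### Poisson summation and the complementary modulus -/

lemma betaIntegral_half_add_half_sub (η : ℝ) :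
    Complex.betaIntegral (1 / 2 + η * Complex.I) (1 / 2 - η * Complex.I) =
      ((π / cosh (π * η) : ℝ) : ℂ) := by
  have h := Complex.Gamma_mul_Gamma_eq_betaIntegral (s := 1 / 2 + η * Complex.I)
    (t := 1 / 2 - η * Complex.I) (by simp) (by simp)
  rw [show (1 / 2 + η * Complex.I : ℂ) + (1 / 2 - η * Complex.I) = 1 by ring, Complex.Gamma_one,
    one_mul, show (1 / 2 - η * Complex.I : ℂ) = 1 - (1 / 2 + η * Complex.I) by ring,
    Complex.Gamma_mul_Gamma_one_sub,
    show (π : ℂ) * (1 / 2 + η * Complex.I) = (π * η : ℝ) * Complex.I + π / 2 by push_cast; ring,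
    Complex.sin_add_pi_div_two, Complex.cos_mul_I] at h
  rw [show (1 / 2 - η * Complex.I : ℂ) = 1 - (1 / 2 + η * Complex.I) by ring, ← h]
  push_cast
  rfl

lemma exp_half_log_sigmoid_add (s : ℝ) :
    exp ((log (sigmoid s) + log (1 - sigmoid s)) / 2) = 1 / (2 * cosh (s / 2)) := by
  have h1 : 0 < 1 - sigmoid s := sub_pos.mpr (sigmoid_lt_one s)
  have h2 : exp (-s) * sigmoid s = 1 - sigmoid s := by
    rw [mul_comm, sigmoid_mul_rexp_neg, sigmoid_neg]
  have h3 : log (1 - sigmoid s) = log (sigmoid s) - s := by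
    rw [← h2, log_mul (exp_pos _).ne' (sigmoid_pos s).ne', log_exp]; ring
  rw [eq_div_iff (by positivity), cosh_eq, mul_div_cancel₀ _ two_ne_zero, mul_add, ← exp_add,
    ← exp_add, show (log (sigmoid s) + log (1 - sigmoid s)) / 2 + s / 2 = log (sigmoid s) by
      rw [h3]; ring,
    show (log (sigmoid s) + log (1 - sigmoid s)) / 2 + -(s / 2) = log (1 - sigmoid s) by
      rw [h3]; ring, exp_log (sigmoid_pos s), exp_log h1]
  ring

lemma log_sigmoid_sub (s : ℝ) : log (sigmoid s) - log (1 - sigmoid s) = s := by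
  rw [← sigmoid_neg, ← sigmoid_mul_rexp_neg, log_mul (sigmoid_pos s).ne' (exp_pos _).ne', log_exp]
  ring

lemma sigmoid_cpow_mul_cpow (s η : ℝ) :
    ((sigmoid s * (1 - sigmoid s) : ℝ) : ℂ) * ((sigmoid s : ℂ) ^ (1 / 2 + η * Complex.I - 1) *
      (1 - (sigmoid s : ℂ)) ^ (1 / 2 - η * Complex.I - 1)) =
      Complex.exp (η * s * Complex.I) * ((1 / (2 * cosh (s / 2)) : ℝ) : ℂ) := by
  have h0 : (sigmoid s : ℂ) ≠ 0 := Complex.ofReal_ne_zero.mpr (sigmoid_pos s).ne'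
  have h1 : 0 < 1 - sigmoid s := sub_pos.mpr (sigmoid_lt_one s)
  have h1' : ((1 - sigmoid s : ℝ) : ℂ) ≠ 0 := Complex.ofReal_ne_zero.mpr h1.ne'
  have hl := congrArg (fun r : ℝ => (r : ℂ)) (log_sigmoid_sub s)
  have e1 : (1 - (sigmoid s : ℂ)) = ((1 - sigmoid s : ℝ) : ℂ) := by push_cast; rfl
  rw [← exp_half_log_sigmoid_add, e1, Complex.cpow_sub _ _ h0, Complex.cpow_sub _ _ h1',
    Complex.cpow_one, Complex.cpow_one, Complex.ofReal_mul]
  rw [Complex.cpow_def_of_ne_zero h0, Complex.cpow_def_of_ne_zero h1', ← Complex.ofReal_log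
    (sigmoid_pos s).le, ← Complex.ofReal_log h1.le]
  have : ∀ x y u v : ℂ, x ≠ 0 → y ≠ 0 → x * y * (u / x * (v / y)) = u * v := fun x y u v hx hy => by
    field_simp
  rw [this _ _ _ _ h0 h1', ← Complex.exp_add, Complex.ofReal_exp, ← Complex.exp_add]
  congr 1
  rw [Complex.ofReal_sub] at hl
  rw [← hl]
  push_cast
  ring

lemma integral_exp_div_cosh {a : ℝ} (ha : 0 < a) (η : ℝ) :
    ∫ x : ℝ, Complex.exp (((2 * a * η * x : ℝ) : ℂ) * Complex.I) * ((1 / cosh (a * x) : ℝ) : ℂ) =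
      ((π / (a * cosh (π * η)) : ℝ) : ℂ) := by
  have hderiv : ∀ x : ℝ, HasDerivAt (fun x => sigmoid (2 * a * x))
      (sigmoid (2 * a * x) * (1 - sigmoid (2 * a * x)) * (2 * a)) x := fun x => by
    have h := (hasDerivAt_sigmoid (2 * a * x)).comp x ((hasDerivAt_id x).const_mul (2 * a))
    exact h.congr_deriv (by rw [mul_one])
  have hinj : Function.Injective fun x => sigmoid (2 * a * x) := fun x y h => by
    have := sigmoid_injective h
    exact mul_left_cancel₀ (by positivity) this
  have hrange : (fun x => sigmoid (2 * a * x)) '' Set.univ = Set.Ioo 0 1 := by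
    rw [Set.image_univ, ← range_sigmoid]
    exact (mul_left_surjective₀ (by positivity : 2 * a ≠ 0)).range_comp sigmoid
  have h := integral_image_eq_integral_abs_deriv_smul MeasurableSet.univ
    (fun x _ => (hderiv x).hasDerivWithinAt) hinj.injOn
    (fun x : ℝ => (x : ℂ) ^ (1 / 2 + η * Complex.I - 1 : ℂ) *
      (1 - (x : ℂ)) ^ (1 / 2 - η * Complex.I - 1 : ℂ))
  rw [hrange, ← integral_Ioc_eq_integral_Ioo, ← intervalIntegral.integral_of_le zero_le_one,
    setIntegral_univ] at h
  have hb := betaIntegral_half_add_half_sub η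
  rw [Complex.betaIntegral, h] at hb
  have ha' : (a : ℂ) ≠ 0 := Complex.ofReal_ne_zero.mpr ha.ne'
  have hterm : ∀ x : ℝ, |sigmoid (2 * a * x) * (1 - sigmoid (2 * a * x)) * (2 * a)| •
      (((sigmoid (2 * a * x) : ℝ) : ℂ) ^ (1 / 2 + η * Complex.I - 1 : ℂ) *
        (1 - ((sigmoid (2 * a * x) : ℝ) : ℂ)) ^ (1 / 2 - η * Complex.I - 1 : ℂ)) =
      a * (Complex.exp (((2 * a * η * x : ℝ) : ℂ) * Complex.I) *
        ((1 / cosh (a * x) : ℝ) : ℂ)) := fun x => by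
    have h1 : 0 < 1 - sigmoid (2 * a * x) := sub_pos.mpr (sigmoid_lt_one _)
    have h0 := sigmoid_pos (2 * a * x)
    rw [abs_of_pos (by positivity), Complex.real_smul, Complex.ofReal_mul, mul_right_comm,
      sigmoid_cpow_mul_cpow, show 2 * a * x / 2 = a * x by ring]
    push_cast
    rw [show (η : ℂ) * (2 * a * x) = 2 * a * η * x by ring]
    ring
  simp_rw [hterm] at hb
  rw [MeasureTheory.integral_const_mul] at hb
  rw [← mul_right_inj' ha', hb]
  push_cast
  field_simp

lemma fourier_one_div_cosh {a : ℝ} (ha : 0 < a) (ξ : ℝ) :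
    FourierTransform.fourier (fun x : ℝ => ((1 / cosh (a * x) : ℝ) : ℂ)) ξ =
      ((π / a * (1 / cosh (π ^ 2 / a * ξ)) : ℝ) : ℂ) := by
  rw [fourier_real_eq_integral_exp_smul]
  have h := integral_exp_div_cosh ha (-(π * ξ / a))
  rw [show π / (a * cosh (π * -(π * ξ / a))) = π / a * (1 / cosh (π ^ 2 / a * ξ)) by
    rw [show π * -(π * ξ / a) = -(π ^ 2 / a * ξ) by ring, cosh_neg]
    field_simp] at h
  rw [← h]
  refine integral_congr_ae (Filter.Eventually.of_forall fun x => ?_)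
  simp only [smul_eq_mul]
  rw [show 2 * a * -(π * ξ / a) * x = -2 * π * x * ξ by field_simp]

lemma one_div_cosh_isBigO {a : ℝ} (ha : 0 < a) :
    (fun x : ℝ => ((1 / cosh (a * x) : ℝ) : ℂ)) =O[Filter.cocompact ℝ]
      fun x : ℝ => |x| ^ (-2 : ℝ) := by
  refine Asymptotics.IsBigO.of_bound (4 / a ^ 2) ?_
  have hne : ∀ᶠ x : ℝ in Filter.cocompact ℝ, x ≠ 0 :=
    (Set.finite_singleton (0 : ℝ)).isCompact.compl_mem_cocompact
  filter_upwards [hne] with x hx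
  have hx0 : 0 < |x| := abs_pos.mpr hx
  rw [Complex.norm_real, Real.norm_of_nonneg (by positivity), Real.norm_of_nonneg (by positivity),
    rpow_neg hx0.le, rpow_two]
  refine (one_div_cosh_le _).trans ?_
  have h := quadratic_le_exp_of_nonneg (abs_nonneg (a * x))
  rw [exp_neg, ← div_eq_mul_inv, ← div_eq_mul_inv, div_div, div_le_div_iff₀ (exp_pos _)
    (by positivity)]
  rw [abs_mul, abs_of_pos ha] at h ⊢
  have : 0 < a * |x| := by positivity
  nlinarith

lemma tsum_sechCoeff {a : ℝ} (ha : 0 < a) (x : ℝ) :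
    ∑' n : ℤ, sechCoeff a x n = π / a * ellD (π ^ 2 / a) (π * x) := by
  have hc : Continuous fun x : ℝ => ((1 / cosh (a * x) : ℝ) : ℂ) :=
    Complex.continuous_ofReal.comp (continuous_const.div
      (continuous_cosh.comp (continuous_const.mul continuous_id)) fun x => (cosh_pos _).ne')
  have hsum : Summable fun n : ℤ =>
      FourierTransform.fourier (fun x : ℝ => ((1 / cosh (a * x) : ℝ) : ℂ)) n := by
    simp_rw [fourier_one_div_cosh ha]
    refine Complex.ofRealCLM.summable (Summable.mul_left (π / a) ?_)
    refine (expDecay_sechCoeff (a := π ^ 2 / a) (by positivity) 0).summable.congr fun n => ?_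
    rw [sechCoeff, add_zero]
  have h := Real.tsum_eq_tsum_fourier_of_rpow_decay_of_summable hc one_lt_two
    (one_div_cosh_isBigO ha) hsum x
  rw [← Complex.ofReal_inj, Complex.ofReal_mul, ← trigSeries_sech_zero, trigSeries,
    ← tsum_mul_left, Complex.ofReal_tsum]
  convert h using 1
  · refine tsum_congr fun n => ?_
    rw [sechCoeff, add_comm]
  · refine tsum_congr fun n => ?_
    rw [fourier_one_div_cosh ha, fourier_coe_apply, sechCoeff]
    push_cast
    rw [add_zero, ← mul_assoc, add_zero]
    congr 2
    ring

lemma ellD_zero_dual {a : ℝ} (ha : 0 < a) : ellD a 0 = π / a * ellD (π ^ 2 / a) 0 := by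
  rw [ellD_zero a ha, tsum_sechCoeff ha, mul_zero]

lemma ellC_zero_dual {a : ℝ} (ha : 0 < a) : ellC a 0 = π / a * ellD (π ^ 2 / a) (π / 2) := by
  rw [ellC_zero a ha, tsum_sechCoeff ha, mul_one_div]

lemma ellModulus_dual_sq {a : ℝ} (ha : 0 < a) :
    ellModulus (π ^ 2 / a) ^ 2 = 1 - ellModulus a ^ 2 := by
  have h := one_sub_modulus_sq_mul_sin_sq ha (π / 2)
  have hb : 0 < π ^ 2 / a := by positivity
  have hba : π ^ 2 / (π ^ 2 / a) = a := by field_simp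
  rw [ellAm_pi_div_two ha, sin_pi_div_two, one_pow, mul_one] at h
  rw [h, ellModulus, ellD_zero_dual hb, ellC_zero_dual hb, hba, mul_div_mul_left]
  positivity

/-! ### Every modulus is attained -/

lemma sechCoeff_anti {a b : ℝ} (hb : 0 < b) (hab : b ≤ a) (c : ℝ) (n : ℤ) :
    sechCoeff a c n ≤ sechCoeff b c n := by
  refine one_div_le_one_div_of_le (cosh_pos _) (cosh_le_cosh.mpr ?_)
  rw [abs_mul, abs_mul, abs_of_pos hb, abs_of_pos (hb.trans_le hab)]
  gcongr

lemma continuousOn_tsum_sechCoeff {b : ℝ} (hb : 0 < b) (c : ℝ) :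
    ContinuousOn (fun a => ∑' n, sechCoeff a c n) (Set.Ici b) := by
  refine continuousOn_tsum (fun n => ?_) (expDecay_sechCoeff hb c).summable fun n a ha => ?_
  · exact (continuous_const.div (continuous_cosh.comp (continuous_id.mul continuous_const))
      fun a => (cosh_pos _).ne').continuousOn
  · rw [Real.norm_of_nonneg (sechCoeff_pos a c n).le]
    exact sechCoeff_anti hb ha c n

lemma continuousOn_ellModulus {b : ℝ} (hb : 0 < b) : ContinuousOn ellModulus (Set.Ici b) := by
  have hpos : ∀ a ∈ Set.Ici b, 0 < a := fun a ha => hb.trans_le ha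
  refine ContinuousOn.div ?_ ?_ fun a ha => (ellD_pos (hpos a ha) 0).ne'
  · exact (continuousOn_tsum_sechCoeff hb (1 / 2)).congr fun a ha => ellC_zero a (hpos a ha)
  · exact (continuousOn_tsum_sechCoeff hb 0).congr fun a ha => ellD_zero a (hpos a ha)

lemma tendsto_sechCoeff_half (n : ℤ) :
    Filter.Tendsto (fun a => sechCoeff a (1 / 2) n) Filter.atTop (nhds 0) := by
  have h : Filter.Tendsto (fun a : ℝ => 2 * exp (-(a / 2))) Filter.atTop (nhds 0) := by
    have := (tendsto_exp_neg_atTop_nhds_zero.comp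
      (Filter.tendsto_id.atTop_div_const (two_pos : (0 : ℝ) < 2))).const_mul 2
    simpa using this
  refine squeeze_zero' (Filter.Eventually.of_forall fun a => (sechCoeff_pos a _ n).le) ?_ h
  filter_upwards [Filter.eventually_gt_atTop 0] with a ha
  refine (one_div_cosh_le _).trans ?_
  rw [abs_mul, abs_of_pos ha]
  gcongr
  nlinarith [half_odd_abs_ge n]

lemma tendsto_ellModulus : Filter.Tendsto ellModulus Filter.atTop (nhds 0) := by
  have h := tendsto_tsum_of_dominated_convergence (𝓕 := Filter.atTop)
    (f := fun a n => sechCoeff a (1 / 2) n)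
    (expDecay_sechCoeff one_pos (1 / 2)).summable tendsto_sechCoeff_half (by
      filter_upwards [Filter.eventually_ge_atTop 1] with a ha n
      rw [Real.norm_of_nonneg (sechCoeff_pos a _ n).le]
      exact sechCoeff_anti one_pos ha _ n)
  rw [tsum_zero] at h
  refine squeeze_zero' ?_ ?_ h
  · filter_upwards [Filter.eventually_gt_atTop 0] with a ha using (ellModulus_pos ha).le
  · filter_upwards [Filter.eventually_gt_atTop 0] with a ha
    rw [← ellC_zero a ha]
    exact div_le_self (ellC_zero_pos ha).le (one_le_ellD_zero ha)

lemma exists_ellModulus_lt {ε : ℝ} (hε : 0 < ε) : ∃ a, 0 < a ∧ ellModulus a < ε :=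
  ((Filter.eventually_gt_atTop 0).and (tendsto_ellModulus.eventually_lt_const hε)).exists

lemma exists_ellModulus_eq {k : ℝ} (h0 : 0 < k) (h1 : k < 1) : ∃ a, 0 < a ∧ ellModulus a = k := by
  obtain ⟨a, ha, hak⟩ := exists_ellModulus_lt h0
  obtain ⟨b, hb, hbk⟩ := exists_ellModulus_lt
    (sqrt_pos.mpr (by nlinarith : 0 < 1 - k ^ 2))
  have hb' : 0 < π ^ 2 / b := by positivity
  have hkb : k < ellModulus (π ^ 2 / b) := by
    rw [lt_sqrt (ellModulus_pos hb).le] at hbk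
    refine lt_of_pow_lt_pow_left₀ 2 (ellModulus_pos hb').le ?_
    rw [ellModulus_dual_sq hb]
    linarith
  have hc : 0 < min a (π ^ 2 / b) := lt_min ha hb'
  obtain ⟨d, hd, hdk⟩ := isPreconnected_Ici.intermediate_value
    (Set.mem_Ici.mpr (min_le_left a (π ^ 2 / b))) (Set.mem_Ici.mpr (min_le_right _ _))
    (continuousOn_ellModulus hc) ⟨hak.le, hkb.le⟩
  exact ⟨d, hc.trans_le hd, hdk⟩

/-! ### The dilogarithm series -/

lemma one_div_cosh_eq (y : ℝ) : 1 / cosh y = 2 * (exp (-y) / (1 + exp (-y) ^ 2)) := by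
  have h : exp y * exp (-y) = 1 := by rw [← exp_add]; simp
  have h0 := exp_pos (-y)
  rw [cosh_eq, one_div_div, mul_div_assoc', div_eq_div_iff (by positivity) (by positivity)]
  linear_combination (-2) * h

lemma sechCoeff_half_eq (a : ℝ) (n : ℕ) : sechCoeff a (1 / 2) n =
    2 * (exp (-a) ^ n * √(exp (-a)) / (1 + exp (-a) ^ (2 * n + 1))) := by
  have h : exp (-(a * (n + 1 / 2))) = exp (-a) ^ n * √(exp (-a)) := by
    rw [← exp_half, ← exp_nat_mul, ← exp_add]; congr 1; ring
  rw [sechCoeff, one_div_cosh_eq, Int.cast_natCast, h, mul_pow, sq_sqrt (exp_pos _).le, ← pow_mul,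
    ← pow_succ, mul_comm n]

lemma sechCoeff_zero_eq (a : ℝ) (m : ℕ) : sechCoeff a 0 (m + 1) =
    2 * (exp (-a) ^ (m + 1) / (1 + exp (-a) ^ (2 * (m + 1)))) := by
  have h : exp (-(a * ((m + 1 : ℝ) + 0))) = exp (-a) ^ (m + 1) := by
    rw [← exp_nat_mul]; congr 1; push_cast; ring
  rw [sechCoeff, one_div_cosh_eq]
  push_cast
  rw [h, ← pow_mul, mul_comm (m + 1)]

lemma pi_mul_integral_div_integral {a : ℝ} (ha : 0 < a) :
    π * (∫ z in (0 : ℝ)..1, 1 / √((1 - z ^ 2) * (1 - (1 - ellModulus a ^ 2) * z ^ 2))) /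
      (∫ z in (0 : ℝ)..1, 1 / √((1 - z ^ 2) * (1 - ellModulus a ^ 2 * z ^ 2))) = a := by
  have hb : 0 < π ^ 2 / a := by positivity
  rw [← ellModulus_dual_sq ha, integral_ellModulus ha, integral_ellModulus hb, ellD_zero_dual ha]
  have := ellD_pos hb 0
  field_simp

theorem dilog_q_series (k : ℝ) (hk0 : 0 < k) (hk1 : k < 1)
    (K K' q : ℝ)
    (hK : K = ∫ z in (0:ℝ)..1, 1 / Real.sqrt ((1 - z ^ 2) * (1 - k ^ 2 * z ^ 2)))
    (hK' : K' = ∫ z in (0:ℝ)..1, 1 / Real.sqrt ((1 - z ^ 2) * (1 - (1 - k ^ 2) * z ^ 2)))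
    (hq : q = Real.exp (-(Real.pi * K' / K))) :
    (Li2 k - Li2 (-k)) / 8 =
      (∑' n : ℕ, q ^ n * Real.sqrt q /
        (((2 * n + 1 : ℕ) : ℝ) ^ 2 * (1 + q ^ (2 * n + 1))))
      + 4 * ∑' n : ℕ, ∑' m : ℕ,
          q ^ (n + (m + 1)) * Real.sqrt q /
            (((2 * (n : ℝ) + 1) ^ 2 - (2 * ((m : ℝ) + 1)) ^ 2) *
              (1 + q ^ (2 * (m + 1))) * (1 + q ^ (2 * n + 1))) := by
  obtain ⟨a, ha, rfl⟩ := exists_ellModulus_eq hk0 hk1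
  rw [hK, hK', pi_mul_integral_div_integral ha] at hq
  have hκ : ∀ n : ℕ, q ^ n * √q / (1 + q ^ (2 * n + 1)) = sechCoeff a (1 / 2) n / 2 := fun n => by
    rw [sechCoeff_half_eq, hq]; ring
  have hδ : ∀ m : ℕ, q ^ (m + 1) / (1 + q ^ (2 * (m + 1))) = sechCoeff a 0 (m + 1) / 2 :=
    fun m => by rw [sechCoeff_zero_eq, hq]; ring
  have hsingle : ∀ n : ℕ, q ^ n * √q / (((2 * n + 1 : ℕ) : ℝ) ^ 2 * (1 + q ^ (2 * n + 1))) =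
      sechCoeff a (1 / 2) n / 2 / (2 * n + 1) ^ 2 := fun n => by
    rw [← hκ]; push_cast; rw [div_div, mul_comm ((2 * (n : ℝ) + 1) ^ 2)]
  have hdouble : ∀ n m : ℕ, q ^ (n + (m + 1)) * √q /
      (((2 * (n : ℝ) + 1) ^ 2 - (2 * ((m : ℝ) + 1)) ^ 2) *
        (1 + q ^ (2 * (m + 1))) * (1 + q ^ (2 * n + 1))) =
      sechCoeff a (1 / 2) n / (8 * (2 * n + 1)) * (2 * sechCoeff a 0 (m + 1) *
        ((2 * n + 1) / ((2 * n + 1 : ℝ) ^ 2 - (2 * (m + 1)) ^ 2))) := fun n m => by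
    have hn : (2 * n + 1 : ℝ) ≠ 0 := by positivity
    calc _ = (q ^ n * √q / (1 + q ^ (2 * n + 1))) * (q ^ (m + 1) / (1 + q ^ (2 * (m + 1)))) /
          ((2 * n + 1 : ℝ) ^ 2 - (2 * (m + 1)) ^ 2) := by
          rw [div_mul_div_comm, div_div, pow_add]; congr 1 <;> ring
      _ = _ := by
          rw [hκ, hδ, mul_div_assoc' _ (2 * n + 1 : ℝ), mul_div_assoc']
          field_simp
          ring
  have hsum := hasSum_integral_arcsin ha
  have h1 : Summable fun n : ℕ => sechCoeff a (1 / 2) n / 2 / (2 * n + 1 : ℝ) ^ 2 := by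
    refine Summable.of_nonneg_of_le (fun n => ?_) (fun n => ?_)
      ((expDecay_sechCoeff ha (1 / 2)).summable.comp_injective Nat.cast_injective)
    · have := sechCoeff_pos a (1 / 2) n
      positivity
    · have := sechCoeff_pos a (1 / 2) n
      rw [div_div]
      refine div_le_self this.le ?_
      have : (0 : ℝ) ≤ n := n.cast_nonneg
      nlinarith
  have h2 : HasSum (fun n : ℕ => ∑' m : ℕ, q ^ (n + (m + 1)) * √q /
      (((2 * (n : ℝ) + 1) ^ 2 - (2 * ((m : ℝ) + 1)) ^ 2) *
        (1 + q ^ (2 * (m + 1))) * (1 + q ^ (2 * n + 1))))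
      (((∫ y in (0 : ℝ)..π / 2, arcsin (ellModulus a * sin y)) / 4 -
        ∑' n : ℕ, sechCoeff a (1 / 2) n / 2 / (2 * n + 1 : ℝ) ^ 2) / 4) := by
    refine (((hsum.div_const 4).sub h1.hasSum).div_const 4).congr_fun fun n => ?_
    have hn : (2 * n + 1 : ℝ) ≠ 0 := by positivity
    simp_rw [hdouble n]
    rw [tsum_mul_left]
    field_simp
    ring
  rw [h2.tsum_eq, tsum_congr hsingle, Li2_sub_Li2_neg (by rwa [abs_of_pos hk0]),
    integral_arcsin_mul_sin hk0 hk1]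
  ring
end
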